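/- Let b ∈ L^1_loc, r ∈ (1,∞), and let ν be a weight on ℝ^d. (i) If ν is doubling, then ‖M_ν^# b‖_{L^r(ν)} ≲_ν inf_c ‖(b−c)ν^{−1}‖_{L^r(ν)}, where the infimum is over constants c. (ii) If ν ∈ A_{r'}, then inf_c ‖(b−c)ν^{−1}‖_{L^r(ν)} ≲ [ν]_{A_{r'}}^{r−1} [ν]_{A_∞} ‖M_ν^# b‖_{L^r(ν)}. -/

import Mathlib

open MeasureTheory ENNReal Set Filter

noncomputable section

/-- `ℝ^d` with the Euclidean structure. -/
abbrev Rd (d : ℕ) := EuclideanSpace ℝ (Fin d)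

variable {d : ℕ}

/-- An axis-parallel cube in `ℝ^d`, given by a corner and a (positive) side length. -/
structure Cube (d : ℕ) where
  corner : Fin d → ℝ
  side : ℝ
  side_pos : 0 < side

namespace Cube

/-- The set of points of the cube. -/
def carrier (Q : Cube d) : Set (Rd d) :=
  {x | ∀ i, Q.corner i ≤ x i ∧ x i < Q.corner i + Q.side}

/-- The volume `|Q| = ℓ(Q)^d` of the cube. -/
def vol (Q : Cube d) : ℝ := Q.side ^ d

/-- The concentric cube with twice the side length. -/
def double (Q : Cube d) : Cube d :=
  ⟨fun i => Q.corner i - Q.side / 2, 2 * Q.side, by have := Q.side_pos; linarith⟩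

end Cube

/-- `∫_Q f`. -/
def intC (Q : Cube d) (f : Rd d → ℝ) : ℝ := ∫ x in Q.carrier, f x

/-- `w(Q) = ∫_Q w`. -/
def wInt (Q : Cube d) (w : Rd d → ℝ) : ℝ := intC Q w

/-- The average `⟨f⟩_Q = |Q|⁻¹ ∫_Q f`. -/
def avg (Q : Cube d) (f : Rd d → ℝ) : ℝ := Q.vol⁻¹ * intC Q f

/-- The mean oscillation `∫_Q |f - ⟨f⟩_Q|`. -/
def osc (Q : Cube d) (b : Rd d → ℝ) : ℝ := ∫ x in Q.carrier, |b x - avg Q b|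

/-- The conjugate (dual) exponent `p' = p/(p-1)`. -/
def conj (p : ℝ) : ℝ := p / (p - 1)

/-- The weighted Lebesgue norm `‖f‖_{L^p(w)} = (∫ |f|^p w dx)^{1/p}`. -/
def wnorm (p : ℝ) (w : Rd d → ℝ) (f : Rd d → ℝ) : ℝ≥0∞ :=
  (∫⁻ x, ENNReal.ofReal (|f x| ^ p * w x)) ^ (1 / p)

/-- The weighted Lebesgue norm of an `ℝ≥0∞`-valued function. -/
def wnormE (p : ℝ) (w : Rd d → ℝ) (f : Rd d → ℝ≥0∞) : ℝ≥0∞ :=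
  (∫⁻ x, f x ^ p * ENNReal.ofReal (w x)) ^ (1 / p)

/-- A weight: a positive, measurable, locally integrable function. -/
def IsWeight (w : Rd d → ℝ) : Prop :=
  (∀ x, 0 < w x) ∧ Measurable w ∧ LocallyIntegrable w volume

/-- `b ∈ L¹_loc`. -/
def L1loc (b : Rd d → ℝ) : Prop := Measurable b ∧ LocallyIntegrable b volume

/-- Bounded measurable functions with compact support (the class `L^∞_c`). -/
def BddCompactSupp (f : Rd d → ℝ) : Prop :=
  Measurable f ∧ HasCompactSupport f ∧ ∃ M : ℝ, ∀ x, |f x| ≤ M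

/-- `‖U‖_{L^p(μ) → L^q(λ)} ≤ N`, tested on all measurable functions. -/
def OpBound (p q : ℝ) (μ lam : Rd d → ℝ) (U : (Rd d → ℝ) → Rd d → ℝ) (N : ℝ) : Prop :=
  ∀ f : Rd d → ℝ, Measurable f → wnorm q lam (U f) ≤ ENNReal.ofReal N * wnorm p μ f

/-- `‖U‖_{L^p(μ) → L^q(λ)} ≤ N`, tested on the dense class `L^∞_c`. -/
def OpBoundCS (p q : ℝ) (μ lam : Rd d → ℝ) (U : (Rd d → ℝ) → Rd d → ℝ) (N : ℝ) : Prop :=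
  ∀ f : Rd d → ℝ, BddCompactSupp f → wnorm q lam (U f) ≤ ENNReal.ofReal N * wnorm p μ f

/-- The weighted sharp maximal function, with cubes restricted to the family `𝒟`. -/
def sharpMaxOn (𝒟 : Set (Cube d)) (ν b : Rd d → ℝ) (x : Rd d) : ℝ≥0∞ :=
  ⨆ (Q : Cube d) (_ : Q ∈ 𝒟) (_ : x ∈ Q.carrier), ENNReal.ofReal (osc Q b / wInt Q ν)

/-- `‖M^♯_ν b‖_{L^r(ν)}`. -/
def sharpNormOn (𝒟 : Set (Cube d)) (r : ℝ) (ν b : Rd d → ℝ) : ℝ≥0∞ :=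
  wnormE r ν (sharpMaxOn 𝒟 ν b)

/-- `‖b‖_{BMO_ν^α} = sup_Q ν(Q)^{-e} ∫_Q |b - ⟨b⟩_Q|` with `e = 1 + α/d`. -/
def bmoNormOn (𝒟 : Set (Cube d)) (e : ℝ) (ν b : Rd d → ℝ) : ℝ≥0∞ :=
  ⨆ (Q : Cube d) (_ : Q ∈ 𝒟), ENNReal.ofReal (osc Q b / wInt Q ν ^ e)

/-- The Muckenhoupt `A_p` characteristic over the family `𝒟`. -/
def ApCharOn (𝒟 : Set (Cube d)) (p : ℝ) (w : Rd d → ℝ) : ℝ≥0∞ :=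
  ⨆ (Q : Cube d) (_ : Q ∈ 𝒟),
    ENNReal.ofReal (avg Q w * avg Q (fun x => w x ^ (-(conj p / p))) ^ (p / conj p))

/-- `w ∈ A_p` (over the family `𝒟`). -/
def IsApOn (𝒟 : Set (Cube d)) (p : ℝ) (w : Rd d → ℝ) : Prop :=
  IsWeight w ∧ LocallyIntegrable (fun x => w x ^ (-(conj p / p))) volume ∧
    ApCharOn 𝒟 p w < ⊤

/-- The Fujii–Wilson `A_∞` characteristic over the family `𝒟`. -/
def AinfCharOn (𝒟 : Set (Cube d)) (w : Rd d → ℝ) : ℝ≥0∞ :=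
  ⨆ (Q : Cube d) (_ : Q ∈ 𝒟),
    (∫⁻ x in Q.carrier,
        ⨆ (R : Cube d) (_ : R ∈ 𝒟) (_ : x ∈ R.carrier),
          ENNReal.ofReal ((∫ y in Q.carrier ∩ R.carrier, w y) / R.vol)) /
      ENNReal.ofReal (wInt Q w)

/-- The relative Fujii–Wilson characteristic `[w]_{A_∞(ν)}` over the family `𝒟`. -/
def relAinfOn (𝒟 : Set (Cube d)) (w ν : Rd d → ℝ) : ℝ≥0∞ :=
  ⨆ (Q : Cube d) (_ : Q ∈ 𝒟),
    (∫⁻ x in Q.carrier,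
        (⨆ (R : Cube d) (_ : R ∈ 𝒟) (_ : R.carrier ⊆ Q.carrier) (_ : x ∈ R.carrier),
          ENNReal.ofReal (wInt R w / wInt R ν)) * ENNReal.ofReal (ν x)) /
      ENNReal.ofReal (wInt Q w)

/-- The joint Bloom–Muckenhoupt characteristic `[μ',λ,ν]_{B_{p',q}}` (for upper bounds). -/
def BupperOn (𝒟 : Set (Cube d)) (p q : ℝ) (μ' lam ν : Rd d → ℝ) : ℝ≥0∞ :=
  ⨆ (Q : Cube d) (_ : Q ∈ 𝒟),
    ENNReal.ofReal (avg Q μ' ^ (1 / conj p) * avg Q lam ^ (1 / q) *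
      avg Q ν ^ (1 / p + 1 / conj q))

/-- The joint Bloom–Muckenhoupt characteristic `[μ,λ']_{B_{p,q'}(ν)}` (for lower bounds). -/
def BlowerOn (𝒟 : Set (Cube d)) (p q : ℝ) (μ lam' ν : Rd d → ℝ) : ℝ≥0∞ :=
  ⨆ (Q : Cube d) (_ : Q ∈ 𝒟),
    ENNReal.ofReal ((wInt Q μ / wInt Q ν) ^ (1 / p) * (wInt Q lam' / wInt Q ν) ^ (1 / conj q))

/-- A doubling weight. -/
def DoublingWeight (w : Rd d → ℝ) : Prop :=
  ∃ C : ℝ, 0 < C ∧ ∀ Q : Cube d, wInt Q.double w ≤ C * wInt Q w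

/-- A `(γ, ν)`-sparse collection of cubes (with respect to a weight `ν`). -/
def SparseFamily (γ : ℝ) (ν : Rd d → ℝ) (S : Set (Cube d)) : Prop :=
  ∃ E : Cube d → Set (Rd d),
    (∀ Q ∈ S, E Q ⊆ Q.carrier ∧ MeasurableSet (E Q) ∧ γ * wInt Q ν ≤ ∫ x in E Q, ν x) ∧
    S.Pairwise fun Q R => Disjoint (E Q) (E R)

/-- A `(γ, ν)`-sparse collection of cubes (with respect to a measure `ν`). -/
def MSparseFamily (γ : ℝ) (ν : Measure (Rd d)) (S : Set (Cube d)) : Prop :=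
  ∃ E : Cube d → Set (Rd d),
    (∀ Q ∈ S, E Q ⊆ Q.carrier ∧ ENNReal.ofReal γ * ν Q.carrier ≤ ν (E Q)) ∧
    S.Pairwise fun Q R => Disjoint (E Q) (E R)

/-- The weighted sharp maximal function with respect to a measure `ν`. -/
def mSharpMaxOn (𝒟 : Set (Cube d)) (ν : Measure (Rd d)) (b : Rd d → ℝ) (x : Rd d) : ℝ≥0∞ :=
  ⨆ (Q : Cube d) (_ : Q ∈ 𝒟) (_ : x ∈ Q.carrier), ENNReal.ofReal (osc Q b) / ν Q.carrier

/-- The distance between two sets in `ℝ^d`. -/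
def setDist (s t : Set (Rd d)) : ℝ := sInf {r | ∃ x ∈ s, ∃ y ∈ t, r = dist x y}

/-- Supports separated by a positive distance. -/
def SeparatedSupports (f g : Rd d → ℝ) : Prop :=
  ∃ ε : ℝ, 0 < ε ∧ ∀ x ∈ tsupport f, ∀ y ∈ tsupport g, ε ≤ dist x y

/-- A dyadic lattice on `ℝ^d`: for every `k ∈ ℤ` a partition of `ℝ^d` into cubes of
side length `2^{-k}`, each refining the previous one. -/
structure DyadicLattice (d : ℕ) where
  layer : ℤ → Set (Cube d)
  side_eq : ∀ k : ℤ, ∀ Q ∈ layer k, Q.side = (2 : ℝ) ^ (-k)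
  covers : ∀ k : ℤ, ∀ x : Rd d, ∃ Q ∈ layer k, x ∈ Q.carrier
  pairwiseDisjoint : ∀ k : ℤ, ∀ Q ∈ layer k, ∀ R ∈ layer k,
    Q ≠ R → Q.carrier ∩ R.carrier = ∅
  refines : ∀ k : ℤ, ∀ Q ∈ layer (k + 1), ∃ R ∈ layer k, Q.carrier ⊆ R.carrier

/-- The cubes of a dyadic lattice. -/
def DyadicLattice.cubes (D : DyadicLattice d) : Set (Cube d) := {Q | ∃ k, Q ∈ D.layer k}

/-- `𝒟(Q₀)`: the dyadic cubes contained in `Q₀`. -/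
def DyadicLattice.below (D : DyadicLattice d) (Q₀ : Cube d) : Set (Cube d) :=
  {Q ∈ D.cubes | Q.carrier ⊆ Q₀.carrier}

open Classical in
/-- The martingale difference `D_Q b = Σ_{R : R̂ = Q} ⟨b⟩_R 1_R − ⟨b⟩_Q 1_Q`. -/
def DyadicLattice.DQ (D : DyadicLattice d) (Q : Cube d) (b : Rd d → ℝ) (x : Rd d) : ℝ :=
  if h : x ∈ Q.carrier ∧
      ∃ R, R ∈ D.cubes ∧ R.side = Q.side / 2 ∧ x ∈ R.carrier ∧ R.carrier ⊆ Q.carrier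
  then avg h.2.choose b - avg Q b
  else 0

/-- Finite partial sums `Σ_{Q ∈ F} D_Q b ⟨f⟩_Q` of the paraproduct. -/
def parasum (D : DyadicLattice d) (b f : Rd d → ℝ) (F : Finset (Cube d)) (x : Rd d) : ℝ :=
  ∑ Q ∈ F, D.DQ Q b x * avg Q f

/-- Unconditional convergence of the paraproduct sum in `L¹_loc` to the function `S`. -/
def UncondConvL1loc (D : DyadicLattice d) (b f S : Rd d → ℝ) : Prop :=
  ∀ K : Set (Rd d), IsCompact K → ∀ ε : ℝ, 0 < ε →
    ∃ F₀ : Finset (Cube d), ↑F₀ ⊆ D.cubes ∧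
      ∀ F : Finset (Cube d), ↑F ⊆ D.cubes → F₀ ⊆ F →
        ∫ x in K, |parasum D b f F x - S x| < ε

/-- `P` is the dyadic paraproduct `Π_b` associated to `b` and the lattice `D`. -/
def IsParaproduct (D : DyadicLattice d) (b : Rd d → ℝ) (P : (Rd d → ℝ) → Rd d → ℝ) : Prop :=
  ∀ f : Rd d → ℝ, BddCompactSupp f → UncondConvL1loc D b f (P f)

/-- Unconditional convergence of the paraproduct sum in `L^q(λ)` to the function `S`. -/
def UncondConvLq (D : DyadicLattice d) (q : ℝ) (lam : Rd d → ℝ) (b f S : Rd d → ℝ) : Prop :=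
  ∀ ε : ℝ, 0 < ε →
    ∃ F₀ : Finset (Cube d), ↑F₀ ⊆ D.cubes ∧
      ∀ F : Finset (Cube d), ↑F ⊆ D.cubes → F₀ ⊆ F →
        wnorm q lam (fun x => parasum D b f F x - S x) < ENNReal.ofReal ε

/-- A modulus of continuity: increasing with `ω(t) → 0` as `t → 0`. -/
def ModulusOfContinuity (ω : ℝ → ℝ) : Prop :=
  Monotone ω ∧ (∀ t, 0 ≤ ω t) ∧ Tendsto ω (nhdsWithin 0 (Ioi 0)) (nhds 0)

/-- The Dini condition `∫₀¹ ω(t)/t dt < ∞`. -/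
def DiniCondition (ω : ℝ → ℝ) : Prop :=
  IntegrableOn (fun t => ω t / t) (Ioc (0 : ℝ) 1) volume

/-- An `ω`-Calderón–Zygmund kernel. -/
structure CZKernel (d : ℕ) (ω : ℝ → ℝ) where
  kernel : Rd d → Rd d → ℝ
  CK : ℝ
  CK_pos : 0 < CK
  size : ∀ x y : Rd d, x ≠ y → |kernel x y| ≤ CK / dist x y ^ d
  smooth : ∀ x x' y : Rd d, x ≠ y → dist x x' ≤ dist x y / 2 →
    |kernel x y - kernel x' y| + |kernel y x - kernel y x'| ≤
      1 / dist x y ^ d * ω (dist x x' / dist x y)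

/-- Non-degeneracy of a Calderón–Zygmund kernel. -/
def CZKernel.NonDegenerate {d : ℕ} {ω : ℝ → ℝ} (K : CZKernel d ω) : Prop :=
  ∃ c : ℝ, 0 < c ∧ ∀ (x : Rd d) (r : ℝ), 0 < r →
    ∃ y : Rd d, c * r ≤ dist x y ∧ c / r ^ d ≤ |K.kernel y x|

/-- An `ω`-Calderón–Zygmund operator: a linear operator, bounded on some `L^{p₀}`, with an
`ω`-Calderón–Zygmund kernel representation off the support. -/
structure CZOperator (d : ℕ) (ω : ℝ → ℝ) extends CZKernel d ω where
  T : (Rd d → ℝ) → Rd d → ℝ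
  map_add : ∀ f g : Rd d → ℝ, T (f + g) = T f + T g
  map_smul : ∀ (c : ℝ) (f : Rd d → ℝ), T (c • f) = c • T f
  measurable_map : ∀ f : Rd d → ℝ, Measurable f → Measurable (T f)
  p₀ : ℝ
  one_lt_p₀ : 1 < p₀
  N₀ : ℝ
  bounded : ∀ f : Rd d → ℝ, Measurable f →
    wnorm p₀ (fun _ => 1) (T f) ≤ ENNReal.ofReal N₀ * wnorm p₀ (fun _ => 1) f
  kernel_repr : ∀ f : Rd d → ℝ, BddCompactSupp f → ∀ x ∉ tsupport f,
    T f x = ∫ y, kernel x y * f y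

/-- The commutator `[b, T] f = b · Tf − T(b f)`. -/
def commutatorOp (b : Rd d → ℝ) (T : (Rd d → ℝ) → Rd d → ℝ) : (Rd d → ℝ) → Rd d → ℝ :=
  fun f x => b x * T f x - T (fun y => b y * f y) x

/-- The sparse operator `𝒜^⋆_{S,b} f = Σ_{Q∈S} ⟨|b − ⟨b⟩_Q| |f|⟩_Q 1_Q`. -/
def sparseOpStar (S : Set (Cube d)) (b f : Rd d → ℝ) (x : Rd d) : ℝ≥0∞ :=
  ∑' Q : S, (Q : Cube d).carrier.indicator
      (fun _ => ENNReal.ofReal (avg (Q : Cube d) fun y => |b y - avg (Q : Cube d) b| * |f y|)) x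

/-- The sparse operator `f ↦ Σ_{Q∈S} ⟨|b − ⟨b⟩_Q|⟩_Q ⟨|f|⟩_Q 1_Q`. -/
def sparseOp2 (S : Set (Cube d)) (b f : Rd d → ℝ) (x : Rd d) : ℝ≥0∞ :=
  ∑' Q : S, (Q : Cube d).carrier.indicator
      (fun _ => ENNReal.ofReal ((avg (Q : Cube d) fun y => |b y - avg (Q : Cube d) b|) *
        avg (Q : Cube d) fun y => |f y|)) x

/-- The sparse operator `f ↦ Σ_{Q∈S} (|Q|^{-s} ∫_Q |f|^s)^{1/s} 1_Q`. -/
def sparseOpPow (S : Set (Cube d)) (s : ℝ) (f : Rd d → ℝ) (x : Rd d) : ℝ≥0∞ :=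
  ∑' Q : S, (Q : Cube d).carrier.indicator
      (fun _ => ENNReal.ofReal (((Q : Cube d).vol ^ (-s) *
        intC (Q : Cube d) fun y => |f y| ^ s) ^ (1 / s))) x

section MaximalFunction

variable {α ι : Type*} [MeasurableSpace α]

/-- The maximal function of `f` over the family of sets `B`, with respect to the measure `μ`. -/
def maxFn (μ : Measure α) (B : ι → Set α) (f : α → ℝ≥0∞) (x : α) : ℝ≥0∞ :=
  ⨆ (i : ι) (_ : x ∈ B i), (∫⁻ y in B i, f y ∂μ) / μ (B i)

/-- Every finite subfamily of `B` contains a disjoint subfamily carrying a fixed proportion of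
the measure of its union. -/
def CoveringProp (μ : Measure α) (B : ι → Set α) (C : ℝ≥0∞) : Prop :=
  ∀ s : Finset ι, ∃ u : Set ι, u ⊆ s ∧ u.PairwiseDisjoint B ∧
    μ (⋃ i ∈ s, B i) ≤ C * ∑' i : u, μ (B i)

lemma measurable_iSup_mem [Countable ι] {B : ι → Set α} (hB : ∀ i, MeasurableSet (B i))
    (a : ι → ℝ≥0∞) : Measurable fun x => ⨆ (i : ι) (_ : x ∈ B i), a i := by
  refine Measurable.iSup fun i => ?_
  have : (fun x => ⨆ (_ : x ∈ B i), a i) = (B i).indicator fun _ => a i := by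
    ext x
    by_cases hx : x ∈ B i <;> simp [hx]
  rw [this]
  exact measurable_const.indicator (hB i)

lemma measurable_maxFn [Countable ι] {μ : Measure α} {B : ι → Set α}
    (hB : ∀ i, MeasurableSet (B i)) (f : α → ℝ≥0∞) : Measurable (maxFn μ B f) :=
  measurable_iSup_mem hB _

lemma le_maxFn {μ : Measure α} {B : ι → Set α} {f : α → ℝ≥0∞} {x : α} {i : ι} (hx : x ∈ B i) :
    (∫⁻ y in B i, f y ∂μ) / μ (B i) ≤ maxFn μ B f x :=
  le_iSup₂ (f := fun i (_ : x ∈ B i) => (∫⁻ y in B i, f y ∂μ) / μ (B i)) i hx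

lemma maxFn_weak [Countable ι] {μ : Measure α} {B : ι → Set α} (hB : ∀ i, MeasurableSet (B i))
    {C : ℝ≥0∞} (hC : CoveringProp μ B C) (f : α → ℝ≥0∞) (t : ℝ≥0∞) :
    t * μ {x | t < maxFn μ B f x} ≤ C * ∫⁻ x, f x ∂μ := by
  let I : Set ι := {i | t < (∫⁻ y in B i, f y ∂μ) / μ (B i)}
  have hset : {x | t < maxFn μ B f x} = ⋃ s : Finset I, ⋃ i ∈ s.map (Function.Embedding.subtype _),
      B i := by
    ext x
    simp only [maxFn, mem_ofPred_eq, lt_iSup_iff, mem_iUnion]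
    constructor
    · rintro ⟨i, hx, hi⟩
      exact ⟨{⟨i, hi⟩}, i, by simp, hx⟩
    · rintro ⟨s, i, hi, hx⟩
      simp only [Finset.mem_map, Function.Embedding.subtype_apply] at hi
      obtain ⟨a, -, rfl⟩ := hi
      exact ⟨a, hx, a.2⟩
  rw [hset, Directed.measure_iUnion, ENNReal.mul_iSup]
  · refine iSup_le fun s => ?_
    obtain ⟨u, hus, hdis, hle⟩ := hC (s.map (Function.Embedding.subtype _))
    have huI : ∀ i ∈ u, i ∈ I := by
      intro i hi
      have := hus hi
      simp only [Finset.coe_map, Function.Embedding.subtype_apply, mem_image] at this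
      obtain ⟨a, -, rfl⟩ := this
      exact a.2
    calc t * μ (⋃ i ∈ s.map (Function.Embedding.subtype _), B i)
        ≤ t * (C * ∑' i : u, μ (B i)) := by gcongr
      _ = C * ∑' i : u, t * μ (B i) := by rw [ENNReal.tsum_mul_left]; ring
      _ ≤ C * ∑' i : u, ∫⁻ y in B i, f y ∂μ := by
          gcongr with i
          exact ENNReal.mul_le_of_le_div (huI i i.2).le
      _ = C * ∫⁻ y in ⋃ i ∈ u, B i, f y ∂μ := by
          rw [lintegral_biUnion (to_countable u) (fun i _ => hB i) hdis]
      _ ≤ C * ∫⁻ x, f x ∂μ := by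
          gcongr
          exact Measure.restrict_le_self
  · refine Monotone.directed_le fun s s' hs => ?_
    refine biUnion_subset_biUnion_left ?_
    intro i hi
    exact Finset.map_subset_map.2 hs hi

lemma maxFn_weak' [Countable ι] {μ : Measure α} {B : ι → Set α} (hB : ∀ i, MeasurableSet (B i))
    {C : ℝ≥0∞} (hC : CoveringProp μ B C) {f : α → ℝ≥0∞} (hf : Measurable f) (t : ℝ≥0∞) :
    t * μ {x | t < maxFn μ B f x} ≤ 2 * C * ∫⁻ x in {x | t < 2 * f x}, f x ∂μ := by
  have hm : MeasurableSet {x | t < 2 * f x} := measurableSet_lt measurable_const (hf.const_mul 2)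
  let F := {x | t < 2 * f x}.indicator f
  have hF : Measurable F := hf.indicator hm
  have hsub : {x | t < maxFn μ B f x} ⊆ {x | t / 2 < maxFn μ B F x} := by
    intro x hx
    simp only [mem_ofPred_eq] at hx ⊢
    by_contra! hcon
    refine absurd hx (not_lt.2 ?_)
    refine iSup₂_le fun i hi => ?_
    have hle : ∀ y, f y ≤ F y + t / 2 := by
      intro y
      by_cases hy : t < 2 * f y
      · simp [F, hy]
      · simp only [F, indicator, mem_ofPred_eq, hy, if_false, zero_add]
        rw [ENNReal.le_div_iff_mul_le (by simp) (by simp), mul_comm]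
        exact not_lt.1 hy
    calc (∫⁻ y in B i, f y ∂μ) / μ (B i)
        ≤ (∫⁻ y in B i, (F y + t / 2) ∂μ) / μ (B i) := by gcongr with y; exact hle y
      _ = (∫⁻ y in B i, F y ∂μ) / μ (B i) + (t / 2) * (μ (B i) / μ (B i)) := by
          rw [lintegral_add_left hF, setLIntegral_const, ENNReal.add_div, mul_div_assoc]
      _ ≤ t / 2 + (t / 2) * 1 := by
          exact add_le_add ((le_maxFn hi).trans hcon) (mul_le_mul_right ENNReal.div_self_le_one _)
      _ = t := by rw [mul_one, ENNReal.add_halves]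
  calc t * μ {x | t < maxFn μ B f x} ≤ t * μ {x | t / 2 < maxFn μ B F x} := by gcongr
    _ = 2 * (t / 2 * μ {x | t / 2 < maxFn μ B F x}) := by
        rw [← mul_assoc, ENNReal.mul_div_cancel (by simp) (by simp)]
    _ ≤ 2 * (C * ∫⁻ x, F x ∂μ) := mul_le_mul_right (maxFn_weak hB hC F _) _
    _ = _ := by rw [lintegral_indicator hm, mul_assoc]

/-- The constant in the maximal theorem on `L^p`. -/
def maxConst (p : ℝ) : ℝ≥0∞ := ENNReal.ofReal p * (2 * (ENNReal.ofReal (p - 1))⁻¹ * 2 ^ (p - 1))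

lemma maxConst_ne_top {p : ℝ} (hp : 1 < p) : maxConst p ≠ ⊤ := by
  unfold maxConst
  have : (ENNReal.ofReal (p - 1))⁻¹ ≠ ⊤ := by simpa using hp
  have h2 : (2 : ℝ≥0∞) ^ (p - 1) ≠ ⊤ := ENNReal.rpow_ne_top_of_nonneg (by linarith) (by simp)
  finiteness

lemma lintegral_meas_lt_mul {μ : Measure α} {f : α → ℝ≥0∞} (hf : Measurable f)
    (hfin : ∀ᵐ x ∂μ, f x ≠ ⊤) {p : ℝ} (hp : 0 < p) :
    ∫⁻ x, f x ^ p ∂μ = ENNReal.ofReal p * ∫⁻ t in Ioi (0 : ℝ),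
      μ {x | ENNReal.ofReal t < f x} * ENNReal.ofReal (t ^ (p - 1)) := by
  have key := lintegral_rpow_eq_lintegral_meas_lt_mul μ (f := fun x => (f x).toReal)
    (ae_of_all _ fun x => ENNReal.toReal_nonneg) hf.ennreal_toReal.aemeasurable hp
  have h1 : ∫⁻ x, f x ^ p ∂μ = ∫⁻ x, ENNReal.ofReal ((f x).toReal ^ p) ∂μ := by
    refine lintegral_congr_ae ?_
    filter_upwards [hfin] with x hx
    rw [← ENNReal.ofReal_rpow_of_nonneg ENNReal.toReal_nonneg hp.le, ENNReal.ofReal_toReal hx]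
  rw [h1, key]
  congr 1
  refine setLIntegral_congr_fun measurableSet_Ioi fun t ht => ?_
  congr 1
  refine measure_congr ?_
  filter_upwards [hfin] with x hx
  have : (t < (f x).toReal) = (ENNReal.ofReal t < f x) :=
    propext (ENNReal.ofReal_lt_iff_lt_toReal (le_of_lt ht) hx).symm
  exact this

lemma lintegral_rpow_le_of_weak {μ : Measure α} {F f : α → ℝ≥0∞} (hF : Measurable F)
    (hf : Measurable f) {C : ℝ≥0∞} (hC : C ≠ 0) {p : ℝ} (hp : 1 < p)
    (h : ∀ t : ℝ≥0∞, t * μ {x | t < F x} ≤ 2 * C * ∫⁻ x in {x | t < 2 * f x}, f x ∂μ) :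
    ∫⁻ x, F x ^ p ∂μ ≤ maxConst p * C * ∫⁻ x, f x ^ p ∂μ := by
  have hp0 : 0 < p := by linarith
  have hp1 : 0 < p - 1 := by linarith
  by_cases hfin : ∫⁻ x, f x ^ p ∂μ = ⊤
  · rw [hfin, ENNReal.mul_top]
    · exact le_top
    · refine mul_ne_zero (mul_ne_zero (by simpa using hp0) (mul_ne_zero (mul_ne_zero (by simp)
        (by simp)) ?_)) hC
      exact (ENNReal.rpow_pos (by simp) (by simp)).ne'
  have hfae : ∀ᵐ x ∂μ, f x ≠ ⊤ := by
    filter_upwards [ae_lt_top (hf.pow_const p) hfin] with x hx h'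
    simp [h', hp0] at hx
  have hfae' : ∀ᵐ x ∂(μ.withDensity f), 2 * f x ≠ ⊤ := by
    filter_upwards [(withDensity_absolutelyContinuous μ f).ae_le hfae] with x hx
    finiteness
  have hRHS : ∫⁻ t in Ioi (0 : ℝ), (μ.withDensity f) {x | ENNReal.ofReal t < 2 * f x} *
      ENNReal.ofReal (t ^ (p - 1 - 1)) =
      (ENNReal.ofReal (p - 1))⁻¹ * (2 ^ (p - 1) * ∫⁻ x, f x ^ p ∂μ) := by
    have := lintegral_meas_lt_mul (μ := μ.withDensity f) (hf.const_mul 2) hfae' hp1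
    rw [lintegral_withDensity_eq_lintegral_mul _ hf ((hf.const_mul 2).pow_const _)] at this
    have h2 : ∫⁻ x, (f * fun x => (2 * f x) ^ (p - 1)) x ∂μ = 2 ^ (p - 1) * ∫⁻ x, f x ^ p ∂μ := by
      rw [← lintegral_const_mul _ (hf.pow_const p)]
      refine lintegral_congr_ae ?_
      filter_upwards [hfae] with x hx
      simp only [Pi.mul_apply]
      rw [ENNReal.mul_rpow_of_nonneg _ _ hp1.le]
      have : f x ^ p = f x * f x ^ (p - 1) := by
        have := ENNReal.rpow_add_of_nonneg (x := f x) 1 (p - 1) (by simp) hp1.le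
        rw [ENNReal.rpow_one] at this
        rw [← this]; congr 1; ring
      rw [this]; ring
    rw [← h2, this, ← mul_assoc, ENNReal.inv_mul_cancel (by simpa using hp) (by simp), one_mul]
  have htrunc : ∀ n : ℕ, ∫⁻ x, (min (F x) n) ^ p ∂μ ≤ maxConst p * C * ∫⁻ x, f x ^ p ∂μ := by
    intro n
    rw [lintegral_meas_lt_mul (hF.min measurable_const) (ae_of_all _ fun x => by simp) hp0]
    calc ENNReal.ofReal p * ∫⁻ t in Ioi (0 : ℝ),
          μ {x | ENNReal.ofReal t < min (F x) n} * ENNReal.ofReal (t ^ (p - 1))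
        ≤ ENNReal.ofReal p * ∫⁻ t in Ioi (0 : ℝ), 2 * C *
            ((μ.withDensity f) {x | ENNReal.ofReal t < 2 * f x} *
              ENNReal.ofReal (t ^ (p - 1 - 1))) := by
          gcongr ENNReal.ofReal p * ?_
          refine setLIntegral_mono' measurableSet_Ioi fun t ht => ?_
          have ht : 0 < t := ht
          have e : t ^ (p - 1) = t * t ^ (p - 1 - 1) := by
            rw [Real.rpow_sub_one ht.ne' (p - 1)]; field_simp
          rw [e, ENNReal.ofReal_mul ht.le, ← mul_assoc, ← mul_assoc, mul_comm _ (ENNReal.ofReal t)]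
          gcongr ?_ * _
          rw [withDensity_apply _ (measurableSet_lt measurable_const (hf.const_mul 2))]
          refine le_trans ?_ (h (ENNReal.ofReal t))
          gcongr
          exact min_le_left _ _
      _ = _ := by
          have hc : (2 : ℝ≥0∞) * C = 2 * C := rfl
          have hmeas : Measurable fun t : ℝ =>
              (μ.withDensity f) {x | ENNReal.ofReal t < 2 * f x} *
              ENNReal.ofReal (t ^ (p - 1 - 1)) := by
            refine Measurable.mul ?_ (by fun_prop)
            refine Antitone.measurable fun s t hst => measure_mono fun x hx => ?_
            exact lt_of_le_of_lt (ENNReal.ofReal_le_ofReal hst) hx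
          rw [lintegral_const_mul _ hmeas, hRHS]
          unfold maxConst
          ring
  have hsup : ∀ x, F x ^ p = ⨆ n : ℕ, (min (F x) n) ^ p := by
    intro x
    have h1 : ⨆ n : ℕ, min (F x) (n : ℝ≥0∞) = F x := by
      rw [← inf_iSup_eq, ENNReal.iSup_natCast]; simp
    conv_lhs => rw [← h1]
    exact (ENNReal.orderIsoRpow p hp0).map_iSup _
  simp_rw [hsup]
  rw [lintegral_iSup]
  · exact iSup_le htrunc
  · intro n
    exact (hF.min measurable_const).pow_const p
  · intro m n hmn x
    simp only
    gcongr

lemma maxFn_strong [Countable ι] {μ : Measure α} {B : ι → Set α} (hB : ∀ i, MeasurableSet (B i))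
    {C : ℝ≥0∞} (hC0 : C ≠ 0) (hC : CoveringProp μ B C) {f : α → ℝ≥0∞} (hf : Measurable f)
    {p : ℝ} (hp : 1 < p) :
    ∫⁻ x, maxFn μ B f x ^ p ∂μ ≤ maxConst p * C * ∫⁻ x, f x ^ p ∂μ :=
  lintegral_rpow_le_of_weak (measurable_maxFn hB f) hf hC0 hp
    (maxFn_weak' hB hC hf)

end MaximalFunction

section Cubes

namespace Cube

lemma vol_pos (Q : Cube d) : 0 < Q.vol := pow_pos Q.side_pos d

lemma carrier_eq_preimage (Q : Cube d) :
    Q.carrier = WithLp.ofLp ⁻¹' Set.univ.pi fun i => Ico (Q.corner i) (Q.corner i + Q.side) := by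
  ext x
  simp [carrier, Set.mem_pi]

lemma measurableSet (Q : Cube d) : MeasurableSet Q.carrier := by
  rw [carrier_eq_preimage]
  exact (WithLp.measurable_ofLp 2 _) (MeasurableSet.univ_pi fun i => measurableSet_Ico)

lemma volume_carrier (Q : Cube d) : volume Q.carrier = ENNReal.ofReal Q.vol := by
  rw [carrier_eq_preimage, (PiLp.volume_preserving_ofLp (Fin d)).measure_preimage
    (MeasurableSet.univ_pi fun i => measurableSet_Ico).nullMeasurableSet, Real.volume_pi_Ico]
  simp [vol, ENNReal.ofReal_pow Q.side_pos.le]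

lemma volume_ne_zero (Q : Cube d) : volume Q.carrier ≠ 0 := by
  rw [volume_carrier]; simpa using Q.vol_pos

lemma volume_ne_top (Q : Cube d) : volume Q.carrier ≠ ⊤ := by
  rw [volume_carrier]; simp

/-- The closed cube with the same corner and side. -/
def closedCarrier (Q : Cube d) : Set (Rd d) :=
  WithLp.ofLp ⁻¹' Set.univ.pi fun i => Icc (Q.corner i) (Q.corner i + Q.side)

lemma carrier_subset_closed (Q : Cube d) : Q.carrier ⊆ Q.closedCarrier := by
  rw [carrier_eq_preimage]
  exact preimage_mono (pi_mono fun i _ => Ico_subset_Icc_self)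

lemma isClosed_closedCarrier (Q : Cube d) : IsClosed Q.closedCarrier :=
  (isClosed_set_pi fun _ _ => isClosed_Icc).preimage (PiLp.continuous_ofLp 2 _)

lemma dist_le_of_mem_closed {Q : Cube d} {x y : Rd d} (hx : x ∈ Q.closedCarrier)
    (hy : y ∈ Q.closedCarrier) : dist y x ≤ d * Q.side := by
  rw [EuclideanSpace.dist_eq]
  simp only [closedCarrier, mem_preimage, Set.mem_pi, mem_univ, true_imp_iff, mem_Icc] at hx hy
  have h : ∀ i, dist (y i) (x i) ≤ Q.side := fun i => by
    rw [Real.dist_eq, abs_le]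
    constructor <;> linarith [hx i, hy i]
  have hd : (d : ℝ) ≤ (d : ℝ) ^ 2 := by
    exact_mod_cast Nat.le_self_pow two_ne_zero d
  refine Real.sqrt_le_iff.2 ⟨by have := Q.side_pos; positivity, ?_⟩
  calc ∑ i, dist (y i) (x i) ^ 2 ≤ ∑ _i : Fin d, Q.side ^ 2 := by
        gcongr with i; exact h i
    _ = d * Q.side ^ 2 := by simp
    _ ≤ (d : ℝ) ^ 2 * Q.side ^ 2 := by gcongr
    _ = (d * Q.side) ^ 2 := by ring

lemma corner_mem (Q : Cube d) : WithLp.toLp 2 Q.corner ∈ Q.carrier := by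
  intro i
  simp [Q.side_pos]

lemma isBounded_closedCarrier (Q : Cube d) : Bornology.IsBounded Q.closedCarrier :=
  Metric.isBounded_iff.2 ⟨d * Q.side, fun _ hx _ hy => dist_le_of_mem_closed hy hx⟩

lemma integrableOn {f : Rd d → ℝ} (hf : LocallyIntegrable f volume) (Q : Cube d) :
    IntegrableOn f Q.carrier :=
  (hf.integrableOn_isCompact (Metric.isCompact_of_isClosed_isBounded Q.isClosed_closedCarrier
    Q.isBounded_closedCarrier)).mono_set Q.carrier_subset_closed

end Cube

/-- The measure with density `w`. -/
def wMeas (w : Rd d → ℝ) : Measure (Rd d) := volume.withDensity fun x => ENNReal.ofReal (w x)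

lemma wMeas_carrier {w : Rd d → ℝ} (hw : IsWeight w) (Q : Cube d) :
    wMeas w Q.carrier = ENNReal.ofReal (wInt Q w) := by
  rw [wMeas, withDensity_apply _ Q.measurableSet, wInt, intC,
    ofReal_integral_eq_lintegral_ofReal (Q.integrableOn hw.2.2)
      (ae_of_all _ fun x => (hw.1 x).le)]

lemma lintegral_wMeas {w : Rd d → ℝ} (hw : Measurable w) {f : Rd d → ℝ≥0∞} (hf : Measurable f) :
    ∫⁻ x, f x ∂wMeas w = ∫⁻ x, f x * ENNReal.ofReal (w x) := by
  rw [wMeas, lintegral_withDensity_eq_lintegral_mul _ hw.ennreal_ofReal hf]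
  simp only [Pi.mul_apply, mul_comm]

lemma setLIntegral_wMeas {w : Rd d → ℝ} (hw : Measurable w) {f : Rd d → ℝ≥0∞} (hf : Measurable f)
    {s : Set (Rd d)} (hs : MeasurableSet s) :
    ∫⁻ x in s, f x ∂wMeas w = ∫⁻ x in s, f x * ENNReal.ofReal (w x) := by
  rw [wMeas, setLIntegral_withDensity_eq_setLIntegral_mul _ hw.ennreal_ofReal hf hs]
  simp only [Pi.mul_apply, mul_comm]

lemma wInt_pos {w : Rd d → ℝ} (hw : IsWeight w) (Q : Cube d) : 0 < wInt Q w := by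
  rw [wInt, intC, setIntegral_pos_iff_support_of_nonneg_ae (ae_of_all _ fun x => (hw.1 x).le)
    (Q.integrableOn hw.2.2)]
  have : Function.support w = univ := by
    ext x; simpa using (hw.1 x).ne'
  rw [this, univ_inter]
  exact pos_iff_ne_zero.2 Q.volume_ne_zero

lemma wMeas_ne_zero {w : Rd d → ℝ} (hw : IsWeight w) (Q : Cube d) : wMeas w Q.carrier ≠ 0 := by
  rw [wMeas_carrier hw]; simpa using wInt_pos hw Q

lemma wMeas_ne_top {w : Rd d → ℝ} (hw : IsWeight w) (Q : Cube d) : wMeas w Q.carrier ≠ ⊤ := by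
  rw [wMeas_carrier hw]; simp

/-- `∫_Q |b - a|` as an extended nonnegative real. -/
def devE (Q : Cube d) (b : Rd d → ℝ) (a : ℝ) : ℝ≥0∞ := ∫⁻ x in Q.carrier, ENNReal.ofReal |b x - a|

lemma integrableOn_sub_const {b : Rd d → ℝ} (hb : L1loc b) (Q : Cube d) (a : ℝ) :
    IntegrableOn (fun x => b x - a) Q.carrier := by
  have := Q.volume_ne_top
  exact (Q.integrableOn hb.2).sub (integrableOn_const (by simpa using this))

lemma devE_eq {b : Rd d → ℝ} (hb : L1loc b) (Q : Cube d) (a : ℝ) :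
    devE Q b a = ENNReal.ofReal (∫ x in Q.carrier, |b x - a|) := by
  rw [devE, ofReal_integral_eq_lintegral_ofReal (integrableOn_sub_const hb Q a).abs
    (ae_of_all _ fun x => abs_nonneg _)]

lemma devE_ne_top {b : Rd d → ℝ} (hb : L1loc b) (Q : Cube d) (a : ℝ) : devE Q b a ≠ ⊤ := by
  rw [devE_eq hb]; simp

lemma ofReal_osc {b : Rd d → ℝ} (hb : L1loc b) (Q : Cube d) :
    ENNReal.ofReal (osc Q b) = devE Q b (avg Q b) := by
  rw [devE_eq hb, osc]

lemma abs_avg_sub_le {b : Rd d → ℝ} (hb : L1loc b) (Q : Cube d) (a : ℝ) :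
    ENNReal.ofReal |avg Q b - a| ≤ devE Q b a / volume Q.carrier := by
  have hv : volume.real Q.carrier = Q.vol := by
    rw [Measure.real, Q.volume_carrier, ENNReal.toReal_ofReal Q.vol_pos.le]
  have h1 : avg Q b - a = Q.vol⁻¹ * ∫ x in Q.carrier, (b x - a) := by
    rw [integral_sub (Q.integrableOn hb.2) (integrableOn_const (by simpa using Q.volume_ne_top)),
      setIntegral_const, hv, avg, intC, smul_eq_mul]
    have := Q.vol_pos.ne'
    field_simp
  rw [devE_eq hb, Q.volume_carrier, ← ENNReal.ofReal_div_of_pos Q.vol_pos, h1, abs_mul,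
    abs_of_pos (inv_pos.2 Q.vol_pos), inv_mul_eq_div]
  refine ENNReal.ofReal_le_ofReal ?_
  have := Q.vol_pos
  gcongr
  exact abs_integral_le_integral_abs

lemma ofReal_osc_le {b : Rd d → ℝ} (hb : L1loc b) (Q : Cube d) (a : ℝ) :
    ENNReal.ofReal (osc Q b) ≤ 2 * devE Q b a := by
  rw [ofReal_osc hb]
  calc devE Q b (avg Q b)
      ≤ ∫⁻ x in Q.carrier, (ENNReal.ofReal |b x - a| + ENNReal.ofReal |avg Q b - a|) := by
        refine lintegral_mono fun x => ?_
        rw [← ENNReal.ofReal_add (abs_nonneg _) (abs_nonneg _)]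
        refine ENNReal.ofReal_le_ofReal ?_
        rw [abs_sub_comm (avg Q b) a]
        exact abs_sub_le _ _ _
    _ = devE Q b a + ENNReal.ofReal |avg Q b - a| * volume Q.carrier := by
        rw [lintegral_add_right _ measurable_const, setLIntegral_const, devE]
    _ ≤ devE Q b a + devE Q b a := by
        gcongr
        exact ENNReal.mul_le_of_le_div (abs_avg_sub_le hb Q a)
    _ = _ := by ring

end Cubes

section Doubling

/-- The countable family of cubes with rational corners and sides. -/
def ratCube (p : (Fin d → ℚ) × {q : ℚ // 0 < q}) : Cube d :=
  ⟨fun i => p.1 i, p.2, by exact_mod_cast p.2.2⟩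

lemma exists_ratCube (Q : Cube d) : ∃ p, Q.carrier ⊆ (ratCube p : Cube d).carrier ∧
    (ratCube p : Cube d).carrier ⊆ Q.double.double.carrier := by
  have hs := Q.side_pos
  have h1 : ∀ i, ∃ q : ℚ, Q.corner i - Q.side / 2 < q ∧ (q : ℝ) < Q.corner i := fun i =>
    exists_rat_btwn (by linarith)
  choose q hq using h1
  obtain ⟨s, hs1, hs2⟩ := exists_rat_btwn (show 3 * Q.side / 2 < 2 * Q.side by linarith)
  have hs0 : 0 < s := by
    have : (0 : ℝ) < s := by linarith
    exact_mod_cast this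
  refine ⟨⟨q, s, hs0⟩, fun x hx i => ?_, fun x hx i => ?_⟩
  · have := hx i
    have := hq i
    simp only [ratCube]
    constructor <;> linarith
  · have := hx i
    have := hq i
    simp only [ratCube, Cube.double] at *
    constructor <;> linarith

lemma subset_double_of_inter {P Q : Cube d} (h : (P.carrier ∩ Q.carrier).Nonempty)
    (hs : P.side ≤ 2 * Q.side) : P.carrier ⊆ Q.double.double.double.carrier := by
  obtain ⟨x, hxP, hxQ⟩ := h
  intro y hy i
  have := hxP i
  have := hxQ i
  have := hy i
  have := Q.side_pos
  simp only [Cube.double]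
  constructor <;> linarith

lemma wMeas_double_le {ν : Rd d → ℝ} (hν : IsWeight ν) {D : ℝ} (hD : 0 < D)
    (h : ∀ Q : Cube d, wInt Q.double ν ≤ D * wInt Q ν) (Q : Cube d) :
    wMeas ν Q.double.carrier ≤ ENNReal.ofReal D * wMeas ν Q.carrier := by
  rw [wMeas_carrier hν, wMeas_carrier hν, ← ENNReal.ofReal_mul hD.le]
  exact ENNReal.ofReal_le_ofReal (h Q)

lemma coveringProp_of_doubling {ν : Rd d → ℝ} {D : ℝ≥0∞}
    (h : ∀ Q : Cube d, wMeas ν Q.double.carrier ≤ D * wMeas ν Q.carrier)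
    {ι : Type*} [Countable ι] (F : ι → Cube d) :
    CoveringProp (wMeas ν) (fun i => (F i).carrier) (D ^ 3) := by
  intro s
  obtain ⟨R, hR⟩ := (s.finite_toSet.image fun i => (F i).side).bddAbove
  obtain ⟨u, hus, hdis, hu⟩ := Vitali.exists_disjoint_subfamily_covering_enlargement
    (fun i => (F i).carrier) (s : Set ι) (fun i => (F i).side) 2 (by norm_num)
    (fun a _ => (F a).side_pos.le) R (fun a ha => hR (mem_image_of_mem _ ha))
    (fun a _ => ⟨_, (F a).corner_mem⟩)
  refine ⟨u, hus, hdis, ?_⟩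
  have hsub : (⋃ i ∈ s, (F i).carrier) ⊆ ⋃ i ∈ u, (F i).double.double.double.carrier := by
    refine iUnion₂_subset fun i hi => ?_
    obtain ⟨j, hj, hne, hle⟩ := hu i hi
    exact (subset_double_of_inter hne hle).trans
      (subset_biUnion_of_mem (u := fun i => (F i).double.double.double.carrier) hj)
  calc wMeas ν (⋃ i ∈ s, (F i).carrier)
      ≤ ∑' i : u, wMeas ν (F i).double.double.double.carrier :=
        (measure_mono hsub).trans (measure_biUnion_le _ (to_countable u) _)
    _ ≤ ∑' i : u, D ^ 3 * wMeas ν (F i).carrier := by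
        refine ENNReal.tsum_le_tsum fun i => ?_
        calc wMeas ν (F i).double.double.double.carrier
            ≤ D * (D * (D * wMeas ν (F i).carrier)) :=
              (h _).trans (by gcongr; exact (h _).trans (by gcongr; exact h _))
          _ = _ := by ring
    _ = _ := ENNReal.tsum_mul_left

lemma setLIntegral_dev {ν b : Rd d → ℝ} (hν : IsWeight ν) (hb : L1loc b) (c : ℝ) (Q : Cube d) :
    ∫⁻ x in Q.carrier, ENNReal.ofReal |(b x - c) * (ν x)⁻¹| ∂wMeas ν = devE Q b c := by
  have := hb.1
  have := hν.2.1
  rw [setLIntegral_wMeas hν.2.1 (by fun_prop) Q.measurableSet, devE]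
  refine lintegral_congr fun x => ?_
  rw [← ENNReal.ofReal_mul (abs_nonneg _), abs_mul, abs_of_pos (inv_pos.2 (hν.1 x)), mul_assoc,
    inv_mul_cancel₀ (hν.1 x).ne', mul_one]

lemma lintegral_rpow_dev {ν b : Rd d → ℝ} (hν : IsWeight ν) (hb : L1loc b) (c : ℝ) {r : ℝ}
    (hr : 0 ≤ r) :
    ∫⁻ x, ENNReal.ofReal |(b x - c) * (ν x)⁻¹| ^ r ∂wMeas ν =
      ∫⁻ x, ENNReal.ofReal (|(b x - c) * (ν x)⁻¹| ^ r * ν x) := by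
  have := hb.1
  have := hν.2.1
  rw [lintegral_wMeas hν.2.1 (by fun_prop)]
  refine lintegral_congr fun x => ?_
  rw [ENNReal.ofReal_mul (by positivity), ENNReal.ofReal_rpow_of_nonneg (abs_nonneg _) hr]

lemma sharpMaxOn_le_maxFn {ν b : Rd d → ℝ} (hν : IsWeight ν) (hb : L1loc b) {D : ℝ≥0∞}
    (h : ∀ Q : Cube d, wMeas ν Q.double.carrier ≤ D * wMeas ν Q.carrier) (c : ℝ) (x : Rd d) :
    sharpMaxOn univ ν b x ≤ 2 * D ^ 2 * maxFn (wMeas ν)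
      (fun p => (ratCube p : Cube d).carrier)
      (fun x => ENNReal.ofReal |(b x - c) * (ν x)⁻¹|) x := by
  refine iSup_le fun Q => iSup_le fun _ => iSup_le fun hx => ?_
  obtain ⟨p, hp1, hp2⟩ := exists_ratCube Q
  have hmeas : wMeas ν (ratCube p).carrier ≤ D ^ 2 * wMeas ν Q.carrier :=
    calc wMeas ν (ratCube p).carrier ≤ D * (D * wMeas ν Q.carrier) :=
          (measure_mono hp2).trans ((h _).trans (by gcongr; exact h _))
      _ = _ := by ring
  rw [ENNReal.ofReal_div_of_pos (wInt_pos hν Q), ← wMeas_carrier hν]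
  refine le_trans ?_ (mul_le_mul_right (le_maxFn (i := p) (hp1 hx)) _)
  rw [setLIntegral_dev hν hb]
  have h0 := wMeas_ne_zero hν Q
  have h1 := wMeas_ne_top hν Q
  have h2 := wMeas_ne_zero hν (ratCube p)
  have h3 := wMeas_ne_top hν (ratCube p)
  rw [ENNReal.div_le_iff h0 h1, mul_assoc]
  calc ENNReal.ofReal (osc Q b) ≤ 2 * devE Q b c := ofReal_osc_le hb Q c
    _ ≤ 2 * devE (ratCube p) b c := by
        gcongr 2 * ?_
        exact lintegral_mono_set hp1
    _ = 2 * (devE (ratCube p) b c / wMeas ν (ratCube p).carrier *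
          wMeas ν (ratCube p).carrier) := by rw [ENNReal.div_mul_cancel h2 h3]
    _ ≤ 2 * (devE (ratCube p) b c / wMeas ν (ratCube p).carrier *
          (D ^ 2 * wMeas ν Q.carrier)) := by gcongr
    _ = _ := by ring

lemma sharpNorm_le_of_doubling {r : ℝ} (hr : 1 < r) {ν : Rd d → ℝ} (hν : IsWeight ν)
    (hdbl : DoublingWeight ν) :
    ∃ C : ℝ, 0 < C ∧ ∀ b : Rd d → ℝ, L1loc b →
      sharpNormOn Set.univ r ν b ≤
        ENNReal.ofReal C * ⨅ c : ℝ, wnorm r ν fun x => (b x - c) * (ν x)⁻¹ := by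
  obtain ⟨D', hD', hdbl⟩ := hdbl
  have h := wMeas_double_le hν hD' hdbl
  set D := ENNReal.ofReal D' with hDdef
  have hD0 : D ≠ 0 := by simpa [D] using hD'
  have hDtop : D ≠ ⊤ := by simp [D]
  have hr0 : 0 < r := by linarith
  set K : ℝ≥0∞ := 2 * D ^ 2 * (maxConst r * D ^ 3) ^ (1 / r) with hK
  have hKtop : K ≠ ⊤ := by
    have h1 := maxConst_ne_top hr
    have h2 : (maxConst r * D ^ 3) ^ (1 / r) ≠ ⊤ :=
      ENNReal.rpow_ne_top_of_nonneg (by positivity) (by finiteness)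
    finiteness
  refine ⟨K.toReal + 1, by positivity, fun b hb => ?_⟩
  rw [ENNReal.mul_iInf_of_ne (by simp; positivity) (by simp)]
  refine le_iInf fun c => ?_
  have hKle : K ≤ ENNReal.ofReal (K.toReal + 1) := by
    rw [ENNReal.ofReal_add (by positivity) (by simp), ENNReal.ofReal_toReal hKtop]
    exact le_self_add
  refine le_trans ?_ (mul_le_mul_left hKle _)
  have hb1 := hb.1
  have hν1 := hν.2.1
  set f : Rd d → ℝ≥0∞ := fun x => ENNReal.ofReal |(b x - c) * (ν x)⁻¹| with hf
  have hfm : Measurable f := by fun_prop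
  set M := maxFn (wMeas ν) (fun p => (ratCube p : Cube d).carrier) f with hM
  have hMm : Measurable M := measurable_maxFn (fun p => (ratCube p).measurableSet) f
  have hstrong := maxFn_strong (μ := wMeas ν) (B := fun p => (ratCube p : Cube d).carrier)
    (fun p => (ratCube p).measurableSet) (pow_ne_zero 3 hD0)
    (coveringProp_of_doubling h ratCube) hfm hr
  unfold sharpNormOn wnormE wnorm
  calc (∫⁻ x, sharpMaxOn univ ν b x ^ r * ENNReal.ofReal (ν x)) ^ (1 / r)
      ≤ (∫⁻ x, (2 * D ^ 2) ^ r * (M x ^ r * ENNReal.ofReal (ν x))) ^ (1 / r) := by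
        refine ENNReal.rpow_le_rpow (lintegral_mono fun x => ?_) (by positivity)
        rw [← mul_assoc, ← ENNReal.mul_rpow_of_nonneg _ _ hr0.le]
        gcongr
        exact sharpMaxOn_le_maxFn hν hb h c x
    _ = (2 * D ^ 2) * (∫⁻ x, M x ^ r ∂wMeas ν) ^ (1 / r) := by
        rw [lintegral_const_mul _ (by fun_prop), ENNReal.mul_rpow_of_nonneg _ _ (by positivity),
          ← ENNReal.rpow_mul, mul_one_div_cancel hr0.ne', ENNReal.rpow_one,
          lintegral_wMeas hν1 (by fun_prop)]
    _ ≤ (2 * D ^ 2) * (maxConst r * D ^ 3 * ∫⁻ x, f x ^ r ∂wMeas ν) ^ (1 / r) := by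
        gcongr
    _ = K * (∫⁻ x, ENNReal.ofReal (|(b x - c) * (ν x)⁻¹| ^ r * ν x)) ^ (1 / r) := by
        rw [ENNReal.mul_rpow_of_nonneg _ _ (by positivity), hf, lintegral_rpow_dev hν hb c hr0.le,
          hK]
        ring

end Doubling

section Grid

/-- The `j`-th cube of the `k`-th generation of the dyadic grid based at `Q₀`. -/
def grid (Q₀ : Cube d) (k : ℕ) (j : Fin d → ℤ) : Cube d :=
  ⟨fun i => Q₀.corner i + j i * (Q₀.side / 2 ^ k), Q₀.side / 2 ^ k,
    div_pos Q₀.side_pos (by positivity)⟩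

/-- The index of the cube of generation `k` containing `x`. -/
def gridIdx (Q₀ : Cube d) (k : ℕ) (x : Rd d) : Fin d → ℤ :=
  fun i => ⌊(x i - Q₀.corner i) / (Q₀.side / 2 ^ k)⌋

/-- The cube of generation `k` containing `x`. -/
def gridAt (Q₀ : Cube d) (k : ℕ) (x : Rd d) : Cube d := grid Q₀ k (gridIdx Q₀ k x)

variable {Q₀ : Cube d} {k l : ℕ} {j : Fin d → ℤ} {x y : Rd d}

lemma mem_grid : x ∈ (grid Q₀ k j).carrier ↔ gridIdx Q₀ k x = j := by
  have hs : 0 < Q₀.side / 2 ^ k := (grid Q₀ k j).side_pos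
  rw [funext_iff]
  refine forall_congr' fun i => ?_
  rw [gridIdx, Int.floor_eq_iff, le_div_iff₀ hs, div_lt_iff₀ hs]
  simp only [grid]
  constructor <;> rintro ⟨h1, h2⟩ <;> constructor <;> linarith

lemma mem_gridAt : x ∈ (gridAt Q₀ k x).carrier := mem_grid.2 rfl

lemma gridAt_eq (h : x ∈ (grid Q₀ k j).carrier) : gridAt Q₀ k x = grid Q₀ k j := by
  rw [gridAt, mem_grid.1 h]

lemma gridIdx_div (h : k ≤ l) (x : Rd d) (i : Fin d) :
    gridIdx Q₀ k x i = gridIdx Q₀ l x i / ((2 ^ (l - k) : ℕ) : ℤ) := by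
  rw [gridIdx, gridIdx, ← Int.floor_div_natCast]
  congr 1
  have := Q₀.side_pos.ne'
  obtain ⟨m, rfl⟩ := Nat.exists_eq_add_of_le h
  simp only [Nat.add_sub_cancel_left, Nat.cast_pow, Nat.cast_ofNat, pow_add]
  field_simp

lemma gridIdx_congr (h : k ≤ l) (hxy : gridIdx Q₀ l x = gridIdx Q₀ l y) :
    gridIdx Q₀ k x = gridIdx Q₀ k y := by
  ext i
  rw [gridIdx_div h, gridIdx_div h, hxy]

lemma gridAt_subset (h : k ≤ l) : (gridAt Q₀ l x).carrier ⊆ (gridAt Q₀ k x).carrier :=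
  fun _ hy => mem_grid.2 (gridIdx_congr h (mem_grid.1 hy))

lemma gridAt_subset_grid (h : k ≤ l) (hx : x ∈ (grid Q₀ k j).carrier) :
    (gridAt Q₀ l x).carrier ⊆ (grid Q₀ k j).carrier :=
  gridAt_eq hx ▸ gridAt_subset h

lemma grid_zero_zero : grid Q₀ 0 0 = Q₀ := by
  cases Q₀
  simp [grid]

lemma grid_disjoint {j' : Fin d → ℤ} (h : j ≠ j') :
    Disjoint (grid Q₀ k j).carrier (grid Q₀ k j').carrier :=
  Set.disjoint_left.2 fun _ hx hx' => h ((mem_grid.1 hx).symm.trans (mem_grid.1 hx'))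

lemma measurable_gridIdx (k : ℕ) : Measurable (gridIdx Q₀ k) :=
  measurable_pi_lambda _ fun _ => Int.measurable_floor.comp (by fun_prop)

lemma measurable_comp_gridIdx {β : Type*} [MeasurableSpace β] (k : ℕ) (φ : (Fin d → ℤ) → β) :
    Measurable fun x => φ (gridIdx Q₀ k x) :=
  (measurable_of_countable φ).comp (measurable_gridIdx k)

lemma measurable_comp_gridAt {β : Type*} [MeasurableSpace β] (k : ℕ) (φ : Cube d → β) :
    Measurable fun x => φ (gridAt Q₀ k x) :=
  measurable_comp_gridIdx k fun j => φ (grid Q₀ k j)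

lemma volume_gridAt_succ (k : ℕ) (x : Rd d) :
    volume (gridAt Q₀ k x).carrier = 2 ^ d * volume (gridAt Q₀ (k + 1) x).carrier := by
  have h2 : (2 : ℝ≥0∞) ^ d = ENNReal.ofReal (2 ^ d) := by
    rw [ENNReal.ofReal_pow (by norm_num)]; simp
  rw [Cube.volume_carrier, Cube.volume_carrier, h2, ← ENNReal.ofReal_mul (by positivity)]
  congr 1
  simp only [gridAt, grid, Cube.vol]
  rw [← mul_pow]
  congr 1
  field_simp
  ring

/-- The dyadic grid as a family indexed by generation and position. -/
def gridFam (Q₀ : Cube d) (p : ℕ × (Fin d → ℤ)) : Set (Rd d) := (grid Q₀ p.1 p.2).carrier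

lemma measurableSet_gridFam (p : ℕ × (Fin d → ℤ)) : MeasurableSet (gridFam Q₀ p) :=
  Cube.measurableSet _

lemma iSup_gridFam (φ : Cube d → ℝ≥0∞) (x : Rd d) :
    ⨆ (p : ℕ × (Fin d → ℤ)) (_ : x ∈ gridFam Q₀ p), φ (grid Q₀ p.1 p.2) =
      ⨆ k, φ (gridAt Q₀ k x) := by
  refine le_antisymm (iSup₂_le fun p hp => ?_) (iSup_le fun k => ?_)
  · have := gridAt_eq hp
    exact this ▸ le_iSup (fun k => φ (gridAt Q₀ k x)) p.1
  · exact le_iSup₂ (f := fun (p : ℕ × (Fin d → ℤ)) (_ : x ∈ gridFam Q₀ p) =>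
      φ (grid Q₀ p.1 p.2)) (k, gridIdx Q₀ k x) mem_gridAt

lemma maxFn_gridFam (μ : Measure (Rd d)) (f : Rd d → ℝ≥0∞) (x : Rd d) :
    maxFn μ (gridFam Q₀) f x =
      ⨆ k, (∫⁻ y in (gridAt Q₀ k x).carrier, f y ∂μ) / μ (gridAt Q₀ k x).carrier :=
  iSup_gridFam (fun Q => (∫⁻ y in Q.carrier, f y ∂μ) / μ Q.carrier) x

lemma le_maxFn_gridFam (μ : Measure (Rd d)) (f : Rd d → ℝ≥0∞) (k : ℕ) (x : Rd d) :
    (∫⁻ y in (gridAt Q₀ k x).carrier, f y ∂μ) / μ (gridAt Q₀ k x).carrier ≤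
      maxFn μ (gridFam Q₀) f x := by
  rw [maxFn_gridFam]
  exact le_iSup (fun k => (∫⁻ y in (gridAt Q₀ k x).carrier, f y ∂μ) / μ (gridAt Q₀ k x).carrier) k

lemma coveringProp_gridFam (μ : Measure (Rd d)) (Q₀ : Cube d) :
    CoveringProp μ (gridFam Q₀) 1 := by
  intro s
  let δ : ℕ × (Fin d → ℤ) → ℝ := fun p => (grid Q₀ p.1 p.2).side
  obtain ⟨R, hR⟩ := (s.finite_toSet.image δ).bddAbove
  obtain ⟨u, hus, hdis, hu⟩ := Vitali.exists_disjoint_subfamily_covering_enlargement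
    (gridFam Q₀) (s : Set _) δ (3 / 2) (by norm_num)
    (fun a _ => (grid Q₀ a.1 a.2).side_pos.le) R (fun a ha => hR (mem_image_of_mem _ ha))
    (fun a _ => ⟨_, (grid Q₀ a.1 a.2).corner_mem⟩)
  refine ⟨u, hus, hdis, ?_⟩
  have hsub : (⋃ i ∈ s, gridFam Q₀ i) ⊆ ⋃ i ∈ u, gridFam Q₀ i := by
    refine iUnion₂_subset fun p hp => ?_
    obtain ⟨q, hq, ⟨x, hxp, hxq⟩, hle⟩ := hu p hp
    refine Subset.trans ?_ (subset_biUnion_of_mem hq)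
    have hkl : q.1 ≤ p.1 := by
      by_contra! hlt
      have h2 : (2 : ℝ) ^ q.1 ≥ 2 * 2 ^ p.1 := by
        rw [← pow_succ']
        exact pow_le_pow_right₀ (by norm_num) hlt
      simp only [δ, grid] at hle
      have hs := Q₀.side_pos
      rw [← mul_div_assoc, div_le_div_iff₀ (by positivity) (by positivity)] at hle
      have hp2 : (0 : ℝ) < Q₀.side * 2 ^ p.1 := by positivity
      nlinarith
    have h1 := gridAt_subset_grid hkl hxq
    rwa [gridAt_eq hxp] at h1
  rw [one_mul]
  exact (measure_mono hsub).trans (measure_biUnion_le _ (to_countable u) _)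

lemma maxFn_gridFam_strong (μ : Measure (Rd d)) (Q₀ : Cube d) {f : Rd d → ℝ≥0∞}
    (hf : Measurable f) {p : ℝ} (hp : 1 < p) :
    ∫⁻ x, maxFn μ (gridFam Q₀) f x ^ p ∂μ ≤ maxConst p * ∫⁻ x, f x ^ p ∂μ := by
  simpa using maxFn_strong measurableSet_gridFam one_ne_zero (coveringProp_gridFam μ Q₀) hf hp

lemma setLIntegral_mono_of_grid {F G : Rd d → ℝ≥0∞} {μ μ' : Measure (Rd d)} {C : ℝ≥0∞} {k : ℕ}
    (h : ∀ j, ∫⁻ x in (grid Q₀ k j).carrier, F x ∂μ ≤ C * ∫⁻ x in (grid Q₀ k j).carrier, G x ∂μ')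
    (V : Set (Fin d → ℤ)) :
    ∫⁻ x in gridIdx Q₀ k ⁻¹' V, F x ∂μ ≤ C * ∫⁻ x in gridIdx Q₀ k ⁻¹' V, G x ∂μ' := by
  have hV : gridIdx Q₀ k ⁻¹' V = ⋃ j : V, (grid Q₀ k j).carrier := by
    ext x
    simp [mem_grid]
  have hm : ∀ j : V, MeasurableSet (grid Q₀ k j).carrier := fun j => Cube.measurableSet _
  have hd : Pairwise (Function.onFun Disjoint fun j : V => (grid Q₀ k j).carrier) :=
    fun i j hij => grid_disjoint fun h => hij (Subtype.ext h)
  rw [hV, lintegral_iUnion hm hd, lintegral_iUnion hm hd, ← ENNReal.tsum_mul_left]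
  exact ENNReal.tsum_le_tsum fun j => h j

end Grid

section Embedding

variable {ν : Rd d → ℝ}

/-- The average of `ν` over `Q`, as an extended nonnegative real. -/
def wAvg (ν : Rd d → ℝ) (Q : Cube d) : ℝ≥0∞ := wMeas ν Q.carrier / volume Q.carrier

lemma setLIntegral_iSup_wAvg_le (hν : IsWeight ν) (Q₀ : Cube d) (k : ℕ) (j : Fin d → ℤ) :
    ∫⁻ x in (grid Q₀ k j).carrier, ⨆ (l : ℕ) (_ : k ≤ l), wAvg ν (gridAt Q₀ l x) ≤
      AinfCharOn univ ν * wMeas ν (grid Q₀ k j).carrier := by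
  set R := grid Q₀ k j with hR
  rw [← ENNReal.div_le_iff_le_mul (Or.inl (wMeas_ne_zero hν R)) (Or.inl (wMeas_ne_top hν R)),
    wMeas_carrier hν]
  refine le_trans (ENNReal.div_le_div_right ?_ _)
    (le_iSup₂ (f := fun (Q : Cube d) (_ : Q ∈ univ) => (∫⁻ x in Q.carrier,
        ⨆ (R : Cube d) (_ : R ∈ univ) (_ : x ∈ R.carrier),
          ENNReal.ofReal ((∫ y in Q.carrier ∩ R.carrier, ν y) / R.vol)) /
      ENNReal.ofReal (wInt Q ν)) R (mem_univ R))
  refine setLIntegral_mono' R.measurableSet fun x hx => iSup₂_le fun l hl => ?_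
  refine le_trans (le_of_eq ?_) (le_iSup_of_le (gridAt Q₀ l x) (le_iSup₂ (mem_univ _) mem_gridAt))
  rw [inter_eq_self_of_subset_right (gridAt_subset_grid hl hx), wAvg, wMeas_carrier hν,
    Cube.volume_carrier, ENNReal.ofReal_div_of_pos (Cube.vol_pos _)]
  rfl

/-- A Carleson-type embedding for the dyadic grid, with the `A_∞` characteristic as constant. -/
lemma lintegral_iSup_mul_wAvg_le (hν : IsWeight ν) (Q₀ : Cube d) (c : Cube d → ℝ≥0∞) :
    ∫⁻ x, ⨆ k, c (gridAt Q₀ k x) * wAvg ν (gridAt Q₀ k x) ≤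
      AinfCharOn univ ν * ∫⁻ x, ⨆ k, c (gridAt Q₀ k x) ∂wMeas ν := by
  let s : ℕ → Rd d → ℝ≥0∞ := fun k x => (Finset.range k).sup fun i => c (gridAt Q₀ i x)
  let δ : ℕ → Rd d → ℝ≥0∞ := fun k x => s (k + 1) x - s k x
  let S : ℕ → Rd d → ℝ≥0∞ := fun k x => ⨆ (l : ℕ) (_ : k ≤ l), wAvg ν (gridAt Q₀ l x)
  have hs_mono : ∀ k x, s k x ≤ s (k + 1) x := fun k x =>
    Finset.sup_mono (Finset.range_mono k.le_succ)
  have hsum : ∀ n x, ∑ k ∈ Finset.range n, δ k x = s n x := by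
    intro n x
    induction n with
    | zero => simp [s]
    | succ n ih => rw [Finset.sum_range_succ, ih, add_tsub_cancel_of_le (hs_mono n x)]
  have hsle : ∀ n x, s n x ≤ ⨆ k, c (gridAt Q₀ k x) := fun n x =>
    Finset.sup_le fun i _ => le_iSup (fun k => c (gridAt Q₀ k x)) i
  have hs_meas : ∀ k, Measurable (s k) := fun k => by
    have h : s k = fun x => ⨆ (i : ℕ) (_ : i ∈ Finset.range k), c (gridAt Q₀ i x) := by
      ext x
      exact Finset.sup_eq_iSup _ _
    rw [h]
    exact Measurable.iSup fun i => Measurable.iSup fun _ => measurable_comp_gridAt i c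
  have hδ_meas : ∀ k, Measurable (δ k) := fun k => (hs_meas _).sub (hs_meas _)
  have hS_meas : ∀ k, Measurable (S k) := fun k =>
    Measurable.iSup fun l => Measurable.iSup fun _ => measurable_comp_gridAt l (wAvg ν)
  have hs_congr : ∀ n k x y, n ≤ k + 1 → gridIdx Q₀ k x = gridIdx Q₀ k y → s n x = s n y := by
    intro n k x y hn hxy
    refine Finset.sup_congr rfl fun i hi => ?_
    have hik : i ≤ k := by have := Finset.mem_range.1 hi; omega
    simp only [gridAt, gridIdx_congr hik hxy]
  have hpt : ∀ x, ⨆ k, c (gridAt Q₀ k x) * wAvg ν (gridAt Q₀ k x) ≤ ∑' k, δ k x * S k x := by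
    refine fun x => iSup_le fun k => ?_
    calc c (gridAt Q₀ k x) * wAvg ν (gridAt Q₀ k x)
        ≤ (∑ i ∈ Finset.range (k + 1), δ i x) * wAvg ν (gridAt Q₀ k x) := by
          rw [hsum]
          gcongr
          exact Finset.le_sup (f := fun i => c (gridAt Q₀ i x)) (Finset.self_mem_range_succ k)
      _ = ∑ i ∈ Finset.range (k + 1), δ i x * wAvg ν (gridAt Q₀ k x) := Finset.sum_mul _ _ _
      _ ≤ ∑ i ∈ Finset.range (k + 1), δ i x * S i x := by
          refine Finset.sum_le_sum fun i hi => ?_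
          gcongr
          exact le_iSup₂ (f := fun l (_ : i ≤ l) => wAvg ν (gridAt Q₀ l x)) k
            (by have := Finset.mem_range.1 hi; omega)
      _ ≤ _ := ENNReal.sum_le_tsum _
  have hk : ∀ k, ∫⁻ x, δ k x * S k x ≤ AinfCharOn univ ν * ∫⁻ x, δ k x ∂wMeas ν := by
    intro k
    have h := setLIntegral_mono_of_grid (Q₀ := Q₀) (k := k) (F := fun x => δ k x * S k x)
      (G := δ k) (μ := volume) (μ' := wMeas ν) (C := AinfCharOn univ ν) ?_ univ
    · simpa using h
    intro j
    set R := grid Q₀ k j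
    have hconst : ∀ x ∈ R.carrier, δ k x = δ k (WithLp.toLp 2 R.corner) := fun x hx => by
      have hi : gridIdx Q₀ k x = gridIdx Q₀ k (WithLp.toLp 2 R.corner) :=
        (mem_grid.1 hx).trans (mem_grid.1 R.corner_mem).symm
      simp only [δ, hs_congr (k + 1) k _ _ le_rfl hi, hs_congr k k _ _ k.le_succ hi]
    rw [setLIntegral_congr_fun R.measurableSet hconst, setLIntegral_congr_fun (g := fun x =>
      δ k (WithLp.toLp 2 R.corner) * S k x) R.measurableSet fun x hx => by simp only [hconst x hx],
      lintegral_const_mul _ (hS_meas k), setLIntegral_const, mul_left_comm]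
    gcongr
    exact setLIntegral_iSup_wAvg_le hν Q₀ k j
  calc ∫⁻ x, ⨆ k, c (gridAt Q₀ k x) * wAvg ν (gridAt Q₀ k x)
      ≤ ∫⁻ x, ∑' k, δ k x * S k x := lintegral_mono hpt
    _ = ∑' k, ∫⁻ x, δ k x * S k x :=
        lintegral_tsum fun k => ((hδ_meas k).mul (hS_meas k)).aemeasurable
    _ ≤ ∑' k, AinfCharOn univ ν * ∫⁻ x, δ k x ∂wMeas ν := ENNReal.tsum_le_tsum hk
    _ = AinfCharOn univ ν * ∫⁻ x, ∑' k, δ k x ∂wMeas ν := by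
        rw [ENNReal.tsum_mul_left, lintegral_tsum fun k => (hδ_meas k).aemeasurable]
    _ ≤ AinfCharOn univ ν * ∫⁻ x, ⨆ k, c (gridAt Q₀ k x) ∂wMeas ν := by
        gcongr with x
        rw [ENNReal.tsum_eq_iSup_nat]
        exact iSup_le fun n => (hsum n x).trans_le (hsle n x)

end Embedding

section Buckley

variable {ν : Rd d → ℝ} {r : ℝ}

lemma conj_sub_one (hr : 1 < r) : conj r - 1 = 1 / (r - 1) := by
  have : r - 1 ≠ 0 := by linarith
  unfold conj
  field_simp
  ring

lemma one_lt_conj (hr : 1 < r) : 1 < conj r := by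
  have h : 0 < conj r - 1 := by
    rw [conj_sub_one hr]
    exact one_div_pos.2 (by linarith)
  linarith

lemma sub_one_mul_conj (hr : 1 < r) : (r - 1) * conj r = r := by
  have : r - 1 ≠ 0 := by linarith
  unfold conj
  field_simp

lemma conj_conj (hr : 1 < r) : conj (conj r) = r := by
  have h1 : r - 1 ≠ 0 := by linarith
  rw [conj, conj_sub_one hr, div_div_eq_mul_div, div_one, mul_comm, sub_one_mul_conj hr]

lemma conj_conj_div (hr : 1 < r) : conj (conj r) / conj r = r - 1 := by
  have h1 : r ≠ 0 := by linarith
  rw [conj_conj hr, conj]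
  field_simp

/-- The weight dual to `ν ∈ A_{r'}`. -/
def dualWeight (r : ℝ) (ν : Rd d → ℝ) (x : Rd d) : ℝ := ν x ^ (1 - r)

lemma ofReal_dualWeight (hν : IsWeight ν) (x : Rd d) :
    ENNReal.ofReal (dualWeight r ν x) = ENNReal.ofReal (ν x) ^ (1 - r) :=
  (ENNReal.ofReal_rpow_of_pos (hν.1 x)).symm

lemma isWeight_dualWeight (hr : 1 < r) (h : IsApOn univ (conj r) ν) :
    IsWeight (dualWeight r ν) := by
  refine ⟨fun x => Real.rpow_pos_of_pos (h.1.1 x) _, h.1.2.1.pow_const _, ?_⟩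
  have := h.2.1
  rw [conj_conj_div hr, neg_sub] at this
  exact this

lemma ofReal_avg {w : Rd d → ℝ} (hw : IsWeight w) (Q : Cube d) :
    ENNReal.ofReal (avg Q w) = wAvg w Q := by
  rw [wAvg, wMeas_carrier hw, Cube.volume_carrier, ← ENNReal.ofReal_div_of_pos Q.vol_pos, avg,
    wInt, inv_mul_eq_div]

lemma wAvg_ne_zero {w : Rd d → ℝ} (hw : IsWeight w) (Q : Cube d) : wAvg w Q ≠ 0 :=
  ENNReal.div_ne_zero.2 ⟨wMeas_ne_zero hw Q, Q.volume_ne_top⟩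

lemma wAvg_ne_top {w : Rd d → ℝ} (hw : IsWeight w) (Q : Cube d) : wAvg w Q ≠ ⊤ :=
  ENNReal.div_ne_top (wMeas_ne_top hw Q) Q.volume_ne_zero

lemma wAvg_dualWeight_le (hr : 1 < r) (h : IsApOn univ (conj r) ν) (Q : Cube d) :
    wAvg (dualWeight r ν) Q ≤ (ApCharOn univ (conj r) ν / wAvg ν Q) ^ (r - 1) := by
  have hr1 : 0 < r - 1 := by linarith
  have hσ := isWeight_dualWeight hr h
  have h1 : wAvg ν Q * wAvg (dualWeight r ν) Q ^ (1 / (r - 1)) ≤ ApCharOn univ (conj r) ν := by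
    refine le_trans (le_of_eq ?_) (le_iSup₂ (f := fun (Q : Cube d) (_ : Q ∈ univ) =>
      ENNReal.ofReal (avg Q ν * avg Q (fun x => ν x ^ (-(conj (conj r) / conj r))) ^
        (conj r / conj (conj r)))) Q (mem_univ Q))
    have h2 : conj r / conj (conj r) = 1 / (r - 1) := by
      rw [← conj_conj_div hr, one_div_div]
    have h3 : (fun x => ν x ^ (-(conj (conj r) / conj r))) = dualWeight r ν := by
      ext x
      rw [conj_conj_div hr, neg_sub, dualWeight]
    have h4 : ∀ {w : Rd d → ℝ}, IsWeight w → 0 ≤ avg Q w := fun hw =>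
      mul_nonneg (inv_nonneg.2 Q.vol_pos.le) (wInt_pos hw Q).le
    rw [h2, h3, ENNReal.ofReal_mul (h4 h.1),
      ← ENNReal.ofReal_rpow_of_nonneg (h4 hσ) (by positivity), ofReal_avg h.1, ofReal_avg hσ]
  rw [← ENNReal.rpow_inv_le_iff hr1, ← one_div,
    ENNReal.le_div_iff_mul_le (Or.inl (wAvg_ne_zero h.1 Q)) (Or.inl (wAvg_ne_top h.1 Q)), mul_comm]
  exact h1

lemma maxFn_le_of_Ap (hr : 1 < r) (h : IsApOn univ (conj r) ν) (Q₀ : Cube d)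
    {g : Rd d → ℝ≥0∞} (hg : Measurable g) (x : Rd d) :
    maxFn volume (gridFam Q₀) g x ≤ (ApCharOn univ (conj r) ν * maxFn (wMeas ν) (gridFam Q₀)
      (fun y => maxFn (wMeas (dualWeight r ν)) (gridFam Q₀)
        (fun z => g z * (ENNReal.ofReal (dualWeight r ν z))⁻¹) y ^ (1 / (r - 1)) *
          (ENNReal.ofReal (ν y))⁻¹) x) ^ (r - 1) := by
  have hr1 : 0 < r - 1 := by linarith
  have hν := h.1
  have hσ := isWeight_dualWeight hr h
  have hνm := hν.2.1
  have hσm := hσ.2.1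
  set σ := dualWeight r ν
  set f : Rd d → ℝ≥0∞ := fun z => g z * (ENNReal.ofReal (σ z))⁻¹ with hf
  have hfm : Measurable f := by fun_prop
  set G := maxFn (wMeas σ) (gridFam Q₀) f
  have hGm : Measurable G := measurable_maxFn measurableSet_gridFam f
  have cancel : ∀ {w : Rd d → ℝ}, IsWeight w → ∀ (a : ℝ≥0∞) y,
      a * (ENNReal.ofReal (w y))⁻¹ * ENNReal.ofReal (w y) = a := fun hw a y => by
    rw [mul_assoc, ENNReal.inv_mul_cancel (by simpa using hw.1 y) (by simp), mul_one]
  rw [maxFn_gridFam]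
  refine iSup_le fun k => ?_
  set Q := gridAt Q₀ k x with hQ
  set a := (∫⁻ y in Q.carrier, f y ∂wMeas σ) / wMeas σ Q.carrier with ha
  have h1 : (∫⁻ y in Q.carrier, g y) / volume Q.carrier = wAvg σ Q * a := by
    have h2 : ∫⁻ y in Q.carrier, f y ∂wMeas σ = ∫⁻ y in Q.carrier, g y := by
      rw [setLIntegral_wMeas hσm hfm Q.measurableSet]
      exact lintegral_congr fun y => cancel hσ _ y
    rw [ha, wAvg, h2, ← ENNReal.mul_div_right_comm,
      ENNReal.mul_div_cancel (wMeas_ne_zero hσ Q) (wMeas_ne_top hσ Q)]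
  have h2 : a ^ (1 / (r - 1)) / wAvg ν Q ≤ maxFn (wMeas ν) (gridFam Q₀)
      (fun y => G y ^ (1 / (r - 1)) * (ENNReal.ofReal (ν y))⁻¹) x := by
    refine le_trans ?_ (le_maxFn_gridFam _ _ k x)
    rw [← hQ, wAvg, setLIntegral_wMeas hνm (by fun_prop) Q.measurableSet]
    simp only [cancel hν]
    rw [ENNReal.div_eq_inv_mul, ENNReal.inv_div (Or.inl Q.volume_ne_top) (Or.inl Q.volume_ne_zero),
      ← ENNReal.mul_div_right_comm]
    refine ENNReal.div_le_div_right ?_ _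
    rw [mul_comm, ← setLIntegral_const]
    refine setLIntegral_mono' Q.measurableSet fun y hy => ?_
    gcongr
    have h3 := le_maxFn_gridFam (Q₀ := Q₀) (wMeas σ) f k y
    rwa [gridAt_eq (Q₀ := Q₀) (j := gridIdx Q₀ k x) hy] at h3
  clear_value a
  rw [h1]
  calc wAvg σ Q * a ≤ (ApCharOn univ (conj r) ν / wAvg ν Q) ^ (r - 1) * a := by
        gcongr; exact wAvg_dualWeight_le hr h Q
    _ = (ApCharOn univ (conj r) ν * (a ^ (1 / (r - 1)) / wAvg ν Q)) ^ (r - 1) := by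
        rw [← mul_div_assoc, ENNReal.mul_div_right_comm, ENNReal.mul_rpow_of_nonneg _ _ hr1.le,
          ← ENNReal.rpow_mul a, one_div_mul_cancel hr1.ne', ENNReal.rpow_one]
    _ ≤ _ := by gcongr

/-- Buckley's theorem for the dyadic maximal operator. -/
lemma lintegral_maxFn_rpow_le_of_Ap (hr : 1 < r) (h : IsApOn univ (conj r) ν) (Q₀ : Cube d)
    {g : Rd d → ℝ≥0∞} (hg : Measurable g) :
    ∫⁻ x, maxFn volume (gridFam Q₀) g x ^ conj r ∂wMeas ν ≤
      ApCharOn univ (conj r) ν ^ r * (maxConst r * maxConst (conj r)) *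
        ∫⁻ x, g x ^ conj r ∂wMeas ν := by
  have hr1 : 0 < r - 1 := by linarith
  have hp := one_lt_conj hr
  have hν := h.1
  have hσ := isWeight_dualWeight hr h
  have hνm := hν.2.1
  have hσm := hσ.2.1
  have hpt := maxFn_le_of_Ap hr h Q₀ hg
  set σ := dualWeight r ν
  set f : Rd d → ℝ≥0∞ := fun z => g z * (ENNReal.ofReal (σ z))⁻¹ with hf
  have hfm : Measurable f := by fun_prop
  set G := maxFn (wMeas σ) (gridFam Q₀) f
  have hGm : Measurable G := measurable_maxFn measurableSet_gridFam f
  set H : Rd d → ℝ≥0∞ := fun y => G y ^ (1 / (r - 1)) * (ENNReal.ofReal (ν y))⁻¹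
  have hHm : Measurable H := by fun_prop
  have hu0 : ∀ x, ENNReal.ofReal (ν x) ≠ 0 := fun x => by simpa using hν.1 x
  have hut : ∀ x, ENNReal.ofReal (ν x) ≠ ⊤ := fun x => by simp
  have hH : ∫⁻ x, H x ^ r ∂wMeas ν = ∫⁻ x, G x ^ conj r ∂wMeas σ := by
    rw [lintegral_wMeas hνm (by fun_prop), lintegral_wMeas hσm (by fun_prop)]
    refine lintegral_congr fun x => ?_
    rw [ENNReal.mul_rpow_of_nonneg _ _ (by linarith), ← ENNReal.rpow_mul, ofReal_dualWeight hν,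
      mul_assoc]
    congr 2
    · rw [conj]; ring
    · nth_rewrite 2 [← ENNReal.rpow_one (ENNReal.ofReal (ν x))]
      rw [ENNReal.inv_rpow, ← ENNReal.rpow_neg, ← ENNReal.rpow_add _ _ (hu0 x) (hut x)]
      ring_nf
  have hF : ∫⁻ x, f x ^ conj r ∂wMeas σ = ∫⁻ x, g x ^ conj r ∂wMeas ν := by
    rw [lintegral_wMeas hνm (by fun_prop), lintegral_wMeas hσm (by fun_prop)]
    refine lintegral_congr fun x => ?_
    simp only [hf]
    rw [ENNReal.mul_rpow_of_nonneg _ _ (by linarith), ofReal_dualWeight hν,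
      mul_assoc, ← ENNReal.rpow_neg, ← ENNReal.rpow_mul, ← ENNReal.rpow_add _ _ (hu0 x) (hut x)]
    congr 1
    have : -(1 - r) * conj r + (1 - r) = 1 := by linear_combination sub_one_mul_conj hr
    rw [this, ENNReal.rpow_one]
  calc ∫⁻ x, maxFn volume (gridFam Q₀) g x ^ conj r ∂wMeas ν
      ≤ ∫⁻ x, ApCharOn univ (conj r) ν ^ r * maxFn (wMeas ν) (gridFam Q₀) H x ^ r ∂wMeas ν := by
        refine lintegral_mono fun x => ?_
        refine (ENNReal.rpow_le_rpow (hpt x) (by linarith)).trans_eq ?_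
        rw [← ENNReal.rpow_mul, sub_one_mul_conj hr, ENNReal.mul_rpow_of_nonneg _ _ (by linarith)]
    _ = ApCharOn univ (conj r) ν ^ r * ∫⁻ x, maxFn (wMeas ν) (gridFam Q₀) H x ^ r ∂wMeas ν :=
        lintegral_const_mul _ ((measurable_maxFn measurableSet_gridFam H).pow_const r)
    _ ≤ ApCharOn univ (conj r) ν ^ r * (maxConst r * (maxConst (conj r) *
          ∫⁻ x, f x ^ conj r ∂wMeas σ)) := by
        gcongr
        refine (maxFn_gridFam_strong _ Q₀ hHm hr).trans ?_
        rw [hH]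
        gcongr
        exact maxFn_gridFam_strong _ Q₀ hfm hp
    _ = _ := by rw [hF]; ring

end Buckley

section Stopping

variable {b : Rd d → ℝ}

/-- The average of `|b - a|` over `Q`. -/
def devAvg (Q : Cube d) (b : Rd d → ℝ) (a : ℝ) : ℝ≥0∞ := devE Q b a / volume Q.carrier

/-- The mean oscillation of `b` over `Q` times the average of `g`. -/
def oscMul (b : Rd d → ℝ) (g : Rd d → ℝ≥0∞) (Q : Cube d) : ℝ≥0∞ :=
  devAvg Q b (avg Q b) * ((∫⁻ y in Q.carrier, g y) / volume Q.carrier)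

lemma devAvg_gridAt_succ_le (Q₀ : Cube d) (a : ℝ) (k : ℕ) (x : Rd d) :
    devAvg (gridAt Q₀ (k + 1) x) b a ≤ 2 ^ d * devAvg (gridAt Q₀ k x) b a := by
  have h1 : devE (gridAt Q₀ (k + 1) x) b a ≤ devE (gridAt Q₀ k x) b a :=
    lintegral_mono_set (gridAt_subset k.le_succ)
  rw [devAvg, devAvg, volume_gridAt_succ k x, ← mul_div_assoc,
    ENNReal.mul_div_mul_left _ _ (by positivity) (by finiteness)]
  gcongr

lemma measurableSet_of_gridIdx {Q₀ : Cube d} {l : ℕ} {U : Set (Rd d)}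
    (hU : gridIdx Q₀ l ⁻¹' (gridIdx Q₀ l '' U) = U) : MeasurableSet U := by
  rw [← hU]
  exact measurable_gridIdx l (MeasurableSet.of_discrete)

lemma exists_stopping (hb : L1loc b) (Q₀ : Cube d) {k n : ℕ} (hkn : k < n) (j : Fin d → ℤ) :
    ∃ U : ℕ → Set (Rd d), (∀ l, U l ⊆ (grid Q₀ k j).carrier) ∧
      (∀ l, gridIdx Q₀ l ⁻¹' (gridIdx Q₀ l '' U l) = U l) ∧
      (Pairwise fun l m => Disjoint (U l) (U m)) ∧
      (∀ l, ∀ x ∈ U l, ENNReal.ofReal |avg (gridAt Q₀ l x) b - avg (grid Q₀ k j) b| ≤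
        2 ^ d * (2 * devAvg (grid Q₀ k j) b (avg (grid Q₀ k j) b))) ∧
      (∀ x ∈ (grid Q₀ k j).carrier, (∀ l ∈ Finset.Ioc k n, x ∉ U l) →
        ENNReal.ofReal |avg (gridAt Q₀ n x) b - avg (grid Q₀ k j) b| ≤
        2 * devAvg (grid Q₀ k j) b (avg (grid Q₀ k j) b)) ∧
      (∀ l, ∀ x ∈ U l, k < l ∧ 2 * devAvg (grid Q₀ k j) b (avg (grid Q₀ k j) b) <
        devAvg (gridAt Q₀ l x) b (avg (grid Q₀ k j) b)) := by
  classical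
  set Q := grid Q₀ k j with hQ
  set a := avg Q b
  set Λ := 2 * devAvg Q b a with hΛ
  let H : ℕ → Rd d → ℝ≥0∞ := fun l x => devAvg (gridAt Q₀ l x) b a
  have hH : ∀ l m x y, m ≤ l → gridIdx Q₀ l x = gridIdx Q₀ l y → H m x = H m y := by
    intro l m x y hm hxy
    simp only [H, gridAt, gridIdx_congr hm hxy]
  have hle : ∀ l x, ENNReal.ofReal |avg (gridAt Q₀ l x) b - a| ≤ H l x := fun l x =>
    abs_avg_sub_le hb _ _
  refine ⟨fun l => {x | x ∈ Q.carrier ∧ k < l ∧ Λ < H l x ∧ ∀ m, k < m → m < l → H m x ≤ Λ},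
    fun l x hx => hx.1, fun l => ?_, ?_, ?_, ?_, fun l x hx => ⟨hx.2.1, hx.2.2.1⟩⟩
  · refine Subset.antisymm ?_ (subset_preimage_image _ _)
    rintro x ⟨y, ⟨h1, h2, h3, h4⟩, hxy⟩
    refine ⟨mem_grid.2 ((gridIdx_congr h2.le hxy).symm.trans (mem_grid.1 h1)), h2, ?_,
      fun m h5 h6 => ?_⟩
    · rwa [← hH l l y x le_rfl hxy]
    · rw [← hH l m y x h6.le hxy]
      exact h4 m h5 h6
  · intro l m hlm
    refine Set.disjoint_left.2 fun x hx hx' => ?_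
    rcases lt_or_gt_of_ne hlm with h | h
    · exact absurd hx.2.2.1 (hx'.2.2.2 l hx.2.1 h).not_gt
    · exact absurd hx'.2.2.1 (hx.2.2.2 m hx'.2.1 h).not_gt
  · rintro l x ⟨h1, h2, h3, h4⟩
    obtain ⟨m, rfl⟩ := Nat.exists_eq_succ_of_ne_zero (Nat.ne_zero_of_lt h2)
    refine (hle _ x).trans ((devAvg_gridAt_succ_le Q₀ a m x).trans ?_)
    gcongr
    rcases (Nat.lt_succ_iff.1 h2).eq_or_lt with rfl | h
    · rw [gridAt_eq h1]
      exact le_mul_of_one_le_left' one_le_two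
    · exact h4 m h m.lt_succ_self
  · intro x hx hxU
    refine (hle n x).trans ?_
    by_contra! hlt
    have hex : ∃ l, k < l ∧ Λ < H l x := ⟨n, hkn, hlt⟩
    refine hxU (Nat.find hex) (Finset.mem_Ioc.2 ⟨(Nat.find_spec hex).1, Nat.find_min' hex
      ⟨hkn, hlt⟩⟩) ⟨hx, (Nat.find_spec hex).1, (Nat.find_spec hex).2, fun m h1 h2 => ?_⟩
    have := Nat.find_min hex h2
    push Not at this
    exact this h1

lemma volume_le_two_mul_diff (hb : L1loc b) {Q₀ : Cube d} {k : ℕ} {j : Fin d → ℤ}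
    {U : Set (Rd d)} (hUm : MeasurableSet U) (hUQ : U ⊆ (grid Q₀ k j).carrier) {a : ℝ}
    (ha : devE (grid Q₀ k j) b a ≠ 0)
    (hU : ∀ x ∈ U, ∃ l, k ≤ l ∧ 2 * devAvg (grid Q₀ k j) b a < devAvg (gridAt Q₀ l x) b a) :
    volume (grid Q₀ k j).carrier ≤ 2 * volume ((grid Q₀ k j).carrier \ U) := by
  set Q := grid Q₀ k j
  set Λ := 2 * devAvg Q b a with hΛ
  have hsub : U ⊆ {x | Λ < maxFn volume (gridFam Q₀)
      (Q.carrier.indicator fun x => ENNReal.ofReal |b x - a|) x} := by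
    intro x hx
    obtain ⟨l, hl, hlt⟩ := hU x hx
    refine hlt.trans_le (le_trans (le_of_eq ?_) (le_maxFn_gridFam _ _ l x))
    rw [setLIntegral_indicator Q.measurableSet,
      inter_eq_self_of_subset_right (gridAt_subset_grid hl (hUQ hx))]
    rfl
  have hw : Λ * volume U ≤ devE Q b a := by
    have h1 := maxFn_weak (μ := volume) measurableSet_gridFam (coveringProp_gridFam volume Q₀)
      (Q.carrier.indicator fun x => ENNReal.ofReal |b x - a|) Λ
    rw [one_mul, lintegral_indicator Q.measurableSet] at h1
    exact (mul_le_mul_right (measure_mono hsub) Λ).trans h1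
  have hd0 : devAvg Q b a ≠ 0 := ENNReal.div_ne_zero.2 ⟨ha, Q.volume_ne_top⟩
  have hdt : devAvg Q b a ≠ ⊤ := ENNReal.div_ne_top (devE_ne_top hb Q a) Q.volume_ne_zero
  have h2 : 2 * volume U ≤ volume Q.carrier := by
    rw [← ENNReal.mul_le_mul_iff_right hd0 hdt]
    calc devAvg Q b a * (2 * volume U) = Λ * volume U := by rw [hΛ]; ring
      _ ≤ devE Q b a := hw
      _ = devAvg Q b a * volume Q.carrier :=
        (ENNReal.div_mul_cancel Q.volume_ne_zero Q.volume_ne_top).symm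
  have hUt : volume U ≠ ⊤ := ne_top_of_le_ne_top Q.volume_ne_top (measure_mono hUQ)
  have h3 : volume Q.carrier = volume U + volume (Q.carrier \ U) := by
    rw [← measure_inter_add_sdiff Q.carrier hUm, inter_eq_self_of_subset_right hUQ]
  refine (ENNReal.add_le_add_iff_left (Q.volume_ne_top)).1 ?_
  calc volume Q.carrier + volume Q.carrier = 2 * volume U + 2 * volume (Q.carrier \ U) := by
        rw [h3]; ring
    _ ≤ _ := by gcongr

/-- Control of dyadic averages, tested against `g`, by a bilinear oscillation maximal function. -/
lemma setLIntegral_avg_sub_le (hb : L1loc b) (Q₀ : Cube d) {g : Rd d → ℝ≥0∞} (hg : Measurable g)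
    (m : ℕ) : ∀ k j, ∫⁻ x in (grid Q₀ k j).carrier,
        ENNReal.ofReal |avg (gridAt Q₀ (k + m) x) b - avg (gridAt Q₀ k x) b| * g x ≤
      2 ^ (d + 2) * ∫⁻ x in (grid Q₀ k j).carrier, ⨆ l, oscMul b g (gridAt Q₀ l x) := by
  induction m using Nat.strong_induction_on with
  | _ m ih =>
  intro k j
  rcases Nat.eq_zero_or_pos m with rfl | hm
  · simp
  obtain ⟨U, hUQ, hUsat, hUdis, hUavg, hUout, hUdev⟩ :=
    exists_stopping hb Q₀ (show k < k + m by omega) j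
  set n := k + m
  set Q := grid Q₀ k j with hQ
  set a := avg Q b
  set Λ := 2 * devAvg Q b a with hΛ
  set N : Rd d → ℝ≥0∞ := fun x => ⨆ l, oscMul b g (gridAt Q₀ l x) with hN
  set V := ⋃ l ∈ Finset.Ioc k n, U l with hV
  have hUm : ∀ l, MeasurableSet (U l) := fun l => measurableSet_of_gridIdx (hUsat l)
  have hVm : MeasurableSet V := Finset.measurableSet_biUnion _ fun l _ => hUm l
  have hVQ : V ⊆ Q.carrier := iUnion₂_subset fun l _ => hUQ l
  have hVint : ∀ F : Rd d → ℝ≥0∞, ∫⁻ x in V, F x = ∑ l ∈ Finset.Ioc k n, ∫⁻ x in U l, F x :=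
    fun F => lintegral_biUnion_finset (fun l _ m _ hlm => hUdis hlm) (fun l _ => hUm l) F
  have hsplit : ∀ F : Rd d → ℝ≥0∞,
      ∫⁻ x in Q.carrier, F x = (∫⁻ x in V, F x) + ∫⁻ x in Q.carrier \ V, F x := fun F => by
    rw [← lintegral_inter_add_sdiff F Q.carrier hVm, inter_eq_self_of_subset_right hVQ]
  have hin : ∀ l ∈ Finset.Ioc k n, ∫⁻ x in U l,
      ENNReal.ofReal |avg (gridAt Q₀ n x) b - avg (gridAt Q₀ k x) b| * g x ≤
      (∫⁻ x in U l, 2 ^ d * Λ * g x) + 2 ^ (d + 2) * ∫⁻ x in U l, N x := by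
    intro l hl
    obtain ⟨hkl, hln⟩ := Finset.mem_Ioc.1 hl
    have h1 := setLIntegral_mono_of_grid (ih (n - l) (by omega) l) (gridIdx Q₀ l '' U l)
    rw [hUsat, show l + (n - l) = n by omega] at h1
    refine le_trans ?_ (add_le_add_right h1 _)
    rw [← lintegral_add_left (hg.const_mul _)]
    refine setLIntegral_mono' (hUm l) fun x hx => ?_
    rw [← add_mul]
    gcongr
    rw [gridAt_eq (hUQ l hx)]
    refine le_trans ?_ (add_le_add_left (hUavg l x hx) _)
    rw [← ENNReal.ofReal_add (abs_nonneg _) (abs_nonneg _), add_comm]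
    exact ENNReal.ofReal_le_ofReal (abs_sub_le _ _ _)
  have hout : ∫⁻ x in Q.carrier \ V,
      ENNReal.ofReal |avg (gridAt Q₀ n x) b - avg (gridAt Q₀ k x) b| * g x ≤
      ∫⁻ x in Q.carrier \ V, 2 ^ d * Λ * g x := by
    refine setLIntegral_mono' (Q.measurableSet.diff hVm) fun x hx => ?_
    gcongr
    rw [gridAt_eq hx.1]
    refine (hUout x hx.1 fun l hl hxl => hx.2 (mem_biUnion hl hxl)).trans ?_
    exact le_mul_of_one_le_left' (one_le_pow₀ one_le_two)
  have hΛg : Λ * ∫⁻ x in Q.carrier, g x ≤ 4 * ∫⁻ x in Q.carrier \ V, N x := by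
    by_cases h0 : devE Q b a = 0
    · simp [hΛ, devAvg, h0]
    have h1 : volume Q.carrier ≤ 2 * volume (Q.carrier \ V) := by
      refine volume_le_two_mul_diff hb hVm hVQ h0 fun x hx => ?_
      obtain ⟨l, _, hl⟩ := mem_iUnion₂.1 hx
      exact ⟨l, (hUdev l x hl).1.le, (hUdev l x hl).2⟩
    have h2 : oscMul b g Q * volume (Q.carrier \ V) ≤ ∫⁻ x in Q.carrier \ V, N x := by
      rw [← setLIntegral_const]
      refine setLIntegral_mono' (Q.measurableSet.diff hVm) fun x hx => ?_
      rw [hQ, ← gridAt_eq hx.1]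
      exact le_iSup (fun l => oscMul b g (gridAt Q₀ l x)) k
    calc Λ * ∫⁻ x in Q.carrier, g x = 2 * (oscMul b g Q * volume Q.carrier) := by
          rw [oscMul, mul_assoc (devAvg _ _ _),
            ENNReal.div_mul_cancel Q.volume_ne_zero Q.volume_ne_top, hΛ, mul_assoc]
      _ ≤ 2 * (oscMul b g Q * (2 * volume (Q.carrier \ V))) := by gcongr
      _ = 4 * (oscMul b g Q * volume (Q.carrier \ V)) := by ring
      _ ≤ _ := by gcongr
  rw [hsplit, hVint]
  calc (∑ l ∈ Finset.Ioc k n, ∫⁻ x in U l,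
        ENNReal.ofReal |avg (gridAt Q₀ n x) b - avg (gridAt Q₀ k x) b| * g x) +
        ∫⁻ x in Q.carrier \ V,
          ENNReal.ofReal |avg (gridAt Q₀ n x) b - avg (gridAt Q₀ k x) b| * g x
      ≤ (∑ l ∈ Finset.Ioc k n, ((∫⁻ x in U l, 2 ^ d * Λ * g x) +
          2 ^ (d + 2) * ∫⁻ x in U l, N x)) + ∫⁻ x in Q.carrier \ V, 2 ^ d * Λ * g x :=
        add_le_add (Finset.sum_le_sum hin) hout
    _ = 2 ^ d * (Λ * ∫⁻ x in Q.carrier, g x) + 2 ^ (d + 2) * ∫⁻ x in V, N x := by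
        rw [Finset.sum_add_distrib, ← hVint, ← Finset.mul_sum, ← hVint, add_right_comm, ← hsplit,
          lintegral_const_mul _ hg, mul_assoc]
    _ ≤ 2 ^ d * (4 * ∫⁻ x in Q.carrier \ V, N x) + 2 ^ (d + 2) * ∫⁻ x in V, N x := by gcongr
    _ = 2 ^ (d + 2) * ∫⁻ x in Q.carrier, N x := by
        rw [hsplit N]
        ring

end Stopping

section Differentiation

variable {b : Rd d → ℝ}

lemma volume_closedBall_cube (Q : Cube d) (x : Rd d) :
    volume (Metric.closedBall x ((d + 1) * Q.side)) =
      ENNReal.ofReal ((d + 1) ^ d) * volume (Metric.closedBall (0 : Rd d) 1) *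
        volume Q.carrier := by
  have hs := Q.side_pos
  rw [Measure.addHaar_closedBall' _ _ (by positivity), Q.volume_carrier, finrank_euclideanSpace,
    Fintype.card_fin, mul_pow, ENNReal.ofReal_mul (by positivity), Cube.vol]
  ring

lemma carrier_subset_closedBall {Q : Cube d} {x : Rd d} (hx : x ∈ Q.carrier) :
    Q.carrier ⊆ Metric.closedBall x ((d + 1) * Q.side) := fun y hy => by
  have h := Cube.dist_le_of_mem_closed (Q.carrier_subset_closed hx) (Q.carrier_subset_closed hy)
  have hs := Q.side_pos
  rw [Metric.mem_closedBall]
  linarith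

lemma ofReal_abs_avg_sub_le (hb : L1loc b) {Q : Cube d} {x : Rd d} (hx : x ∈ Q.carrier) :
    ENNReal.ofReal |avg Q b - b x| ≤
      ENNReal.ofReal ((d + 1) ^ d) * volume (Metric.closedBall (0 : Rd d) 1) *
        ENNReal.ofReal (⨍ y in Metric.closedBall x ((d + 1) * Q.side), ‖b y - b x‖) := by
  set B := Metric.closedBall x ((d + 1) * Q.side) with hB
  have hs := Q.side_pos
  have hBt : volume B ≠ ⊤ := measure_closedBall_lt_top.ne
  have hB0 : volume B ≠ 0 := (Metric.measure_closedBall_pos volume x (by positivity)).ne'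
  have hint : IntegrableOn (fun y => b y - b x) B :=
    (hb.2.integrableOn_isCompact (isCompact_closedBall _ _)).sub
      (integrableOn_const (by simpa using hBt))
  have hav : ENNReal.ofReal (⨍ y in B, ‖b y - b x‖) =
      (∫⁻ y in B, ENNReal.ofReal |b y - b x|) / volume B := by
    rw [setAverage_eq, smul_eq_mul, ENNReal.ofReal_mul (by positivity), Measure.real,
      ENNReal.ofReal_inv_of_pos (ENNReal.toReal_pos hB0 hBt), ENNReal.ofReal_toReal hBt,
      ofReal_integral_eq_lintegral_ofReal hint.norm (ae_of_all _ fun y => norm_nonneg _),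
      mul_comm, ENNReal.div_eq_inv_mul, mul_comm]
    rfl
  have hK := volume_closedBall_cube Q x
  rw [← hB] at hK
  set K := ENNReal.ofReal ((d + 1) ^ d) * volume (Metric.closedBall (0 : Rd d) 1)
  have hQ0 := Q.volume_ne_zero
  have hQt := Q.volume_ne_top
  have hK0 : K ≠ 0 := fun h => hB0 (by rw [hK, h, zero_mul])
  have hKt : K ≠ ⊤ := by
    have := (measure_closedBall_lt_top (μ := volume) (x := (0 : Rd d)) (r := 1)).ne
    finiteness
  rw [hav, hK, ← mul_div_assoc, ENNReal.mul_div_mul_left _ _ hK0 hKt]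
  refine (abs_avg_sub_le hb Q (b x)).trans (ENNReal.div_le_div_right ?_ _)
  exact lintegral_mono_set (carrier_subset_closedBall hx)

lemma tendsto_side_gridAt (Q₀ : Cube d) (x : Rd d) :
    Tendsto (fun n => ((d : ℝ) + 1) * (gridAt Q₀ n x).side) atTop (nhdsWithin 0 (Ioi 0)) := by
  refine tendsto_nhdsWithin_iff.2 ⟨?_, Eventually.of_forall fun n =>
    mul_pos (by positivity) (gridAt Q₀ n x).side_pos⟩
  have h := (tendsto_pow_atTop_nhds_zero_of_lt_one (r := (1 / 2 : ℝ)) (by norm_num)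
    (by norm_num)).const_mul (((d : ℝ) + 1) * Q₀.side)
  rw [mul_zero] at h
  refine h.congr fun n => ?_
  simp only [gridAt, grid, one_div, inv_pow]
  ring

/-- Lebesgue's differentiation theorem along a dyadic grid. -/
lemma ae_tendsto_avg_gridAt (hb : L1loc b) (Q₀ : Cube d) :
    ∀ᵐ x, Tendsto (fun n => avg (gridAt Q₀ n x) b) atTop (nhds (b x)) := by
  filter_upwards [IsUnifLocDoublingMeasure.ae_tendsto_average_norm_sub volume hb.2 1] with x hx
  have h := hx (fun _ => x) _ (tendsto_side_gridAt Q₀ x) (Eventually.of_forall fun n =>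
    Metric.mem_closedBall_self (by have := (gridAt Q₀ n x).side_pos; positivity))
  have h2 := ENNReal.Tendsto.const_mul (a := ENNReal.ofReal ((d + 1) ^ d) *
    volume (Metric.closedBall (0 : Rd d) 1)) (ENNReal.tendsto_ofReal h) (Or.inr
      (by have := (measure_closedBall_lt_top (μ := volume) (x := (0 : Rd d)) (r := 1)).ne
          finiteness))
  rw [ENNReal.ofReal_zero, mul_zero] at h2
  have h3 := tendsto_of_tendsto_of_tendsto_of_le_of_le tendsto_const_nhds h2 (fun n => zero_le)
    fun n => ofReal_abs_avg_sub_le hb (mem_gridAt (Q₀ := Q₀) (k := n) (x := x))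
  have h4 := (ENNReal.tendsto_toReal (by simp)).comp h3
  refine tendsto_iff_norm_sub_tendsto_zero.2 (h4.congr fun n => ?_)
  simp

end Differentiation

section Duality

lemma lintegral_le_of_tendsto {α : Type*} [MeasurableSpace α] {μ : Measure α}
    {F : ℕ → α → ℝ≥0∞} {f : α → ℝ≥0∞} {C : ℝ≥0∞} (hF : ∀ n, Measurable (F n))
    (hlim : ∀ᵐ x ∂μ, Tendsto (fun n => F n x) atTop (nhds (f x)))
    (hC : ∀ n, ∫⁻ x, F n x ∂μ ≤ C) : ∫⁻ x, f x ∂μ ≤ C :=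
  calc ∫⁻ x, f x ∂μ = ∫⁻ x, liminf (fun n => F n x) atTop ∂μ :=
        lintegral_congr_ae (hlim.mono fun _ hx => hx.liminf_eq.symm)
    _ ≤ liminf (fun n => ∫⁻ x, F n x ∂μ) atTop := lintegral_liminf_le hF
    _ ≤ C := liminf_le_of_le (by isBoundedDefault) fun a ha => by
        obtain ⟨n, hn⟩ := ha.exists
        exact hn.trans (hC n)

variable {ν b : Rd d → ℝ} {r : ℝ}

lemma setLIntegral_sub_avg_mul_le (hb : L1loc b) (Q₀ : Cube d) {g : Rd d → ℝ≥0∞}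
    (hg : Measurable g) (hgt : ∀ x, g x ≠ ⊤) :
    ∫⁻ x in Q₀.carrier, ENNReal.ofReal |b x - avg Q₀ b| * g x ≤
      2 ^ (d + 2) * ∫⁻ x, ⨆ l, oscMul b g (gridAt Q₀ l x) := by
  refine lintegral_le_of_tendsto
    (F := fun n x => ENNReal.ofReal |avg (gridAt Q₀ n x) b - avg Q₀ b| * g x) (fun n => ?_) ?_
    fun n => ?_
  · have := measurable_comp_gridAt (Q₀ := Q₀) n (fun R => avg R b)
    fun_prop
  · refine ae_restrict_of_ae ?_
    filter_upwards [ae_tendsto_avg_gridAt hb Q₀] with x hx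
    exact ENNReal.Tendsto.mul_const (ENNReal.tendsto_ofReal (hx.sub_const _).abs)
      (Or.inr (hgt x))
  · have h := setLIntegral_avg_sub_le hb Q₀ hg n 0 0
    rw [grid_zero_zero, zero_add] at h
    refine le_trans (le_of_eq ?_) (h.trans (by gcongr; exact Measure.restrict_le_self))
    refine setLIntegral_congr_fun Q₀.measurableSet fun x hx => ?_
    have h0 : gridAt Q₀ 0 x = Q₀ :=
      (gridAt_eq (grid_zero_zero.symm ▸ hx : x ∈ (grid Q₀ 0 0).carrier)).trans grid_zero_zero
    simp only [h0]

/-- The dyadic version of the weighted sharp maximal function. -/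
def dyadicSharp (ν b : Rd d → ℝ) (Q₀ : Cube d) (x : Rd d) : ℝ≥0∞ :=
  ⨆ k, devE (gridAt Q₀ k x) b (avg (gridAt Q₀ k x) b) / wMeas ν (gridAt Q₀ k x).carrier

lemma measurable_dyadicSharp (Q₀ : Cube d) : Measurable (dyadicSharp ν b Q₀) :=
  Measurable.iSup fun k => measurable_comp_gridAt k
    fun Q => devE Q b (avg Q b) / wMeas ν Q.carrier

lemma dyadicSharp_le (hν : IsWeight ν) (hb : L1loc b) (Q₀ : Cube d) (x : Rd d) :
    dyadicSharp ν b Q₀ x ≤ sharpMaxOn univ ν b x := by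
  refine iSup_le fun k => le_iSup_of_le (gridAt Q₀ k x)
    (le_trans (le_of_eq ?_) (le_iSup₂ (mem_univ _) mem_gridAt))
  rw [ENNReal.ofReal_div_of_pos (wInt_pos hν _), ofReal_osc hb, wMeas_carrier hν]

lemma lintegral_iSup_oscMul_le (hν : IsWeight ν) (Q₀ : Cube d) (g : Rd d → ℝ≥0∞) :
    ∫⁻ x, ⨆ l, oscMul b g (gridAt Q₀ l x) ≤
      AinfCharOn univ ν *
        ∫⁻ x, dyadicSharp ν b Q₀ x * maxFn volume (gridFam Q₀) g x ∂wMeas ν := by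
  let c : Cube d → ℝ≥0∞ := fun Q =>
    devE Q b (avg Q b) / wMeas ν Q.carrier * ((∫⁻ y in Q.carrier, g y) / volume Q.carrier)
  have hc : ∀ Q, oscMul b g Q = c Q * wAvg ν Q := fun Q => by
    have h : devAvg Q b (avg Q b) = devE Q b (avg Q b) / wMeas ν Q.carrier * wAvg ν Q := by
      rw [wAvg, ← mul_div_assoc, ENNReal.div_mul_cancel (wMeas_ne_zero hν Q) (wMeas_ne_top hν Q),
        devAvg]
    rw [oscMul, h, mul_right_comm]
  simp only [hc]
  refine (lintegral_iSup_mul_wAvg_le hν Q₀ c).trans ?_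
  gcongr with x
  refine iSup_le fun k => mul_le_mul' ?_ (le_maxFn_gridFam volume g k x)
  exact le_iSup (fun k => devE (gridAt Q₀ k x) b (avg (gridAt Q₀ k x) b) /
    wMeas ν (gridAt Q₀ k x).carrier) k

lemma lintegral_dyadicSharp_mul_le (hr : 1 < r) (h : IsApOn univ (conj r) ν) (hb : L1loc b)
    (Q₀ : Cube d) {g : Rd d → ℝ≥0∞} (hg : Measurable g) :
    ∫⁻ x, dyadicSharp ν b Q₀ x * maxFn volume (gridFam Q₀) g x ∂wMeas ν ≤
      sharpNormOn univ r ν b * (ApCharOn univ (conj r) ν ^ (r - 1) *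
        (maxConst r * maxConst (conj r)) ^ (1 / conj r) *
        (∫⁻ x, g x ^ conj r ∂wMeas ν) ^ (1 / conj r)) := by
  have hp := one_lt_conj hr
  have hD : Measurable (dyadicSharp ν b Q₀) := measurable_dyadicSharp Q₀
  have hM : Measurable (maxFn volume (gridFam Q₀) g) := measurable_maxFn measurableSet_gridFam g
  have hconj : r.HolderConjugate (conj r) := (Real.holderConjugate_iff_eq_conjExponent hr).2 rfl
  refine (ENNReal.lintegral_mul_le_Lp_mul_Lq _ hconj hD.aemeasurable hM.aemeasurable).trans ?_
  gcongr
  · rw [lintegral_wMeas h.1.2.1 (by fun_prop), sharpNormOn, wnormE]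
    gcongr with x
    exact dyadicSharp_le h.1 hb Q₀ x
  · refine (ENNReal.rpow_le_rpow (lintegral_maxFn_rpow_le_of_Ap hr h Q₀ hg)
      (by positivity)).trans_eq ?_
    have he : r * (1 / conj r) = r - 1 := by
      rw [mul_one_div, div_eq_iff (by positivity), sub_one_mul_conj hr]
    rw [ENNReal.mul_rpow_of_nonneg _ _ (by positivity),
      ENNReal.mul_rpow_of_nonneg _ _ (by positivity), ← ENNReal.rpow_mul, he]

/-- The bound for the oscillation norms obtained by duality. -/
def oscBound (r : ℝ) (ν b : Rd d → ℝ) : ℝ≥0∞ :=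
  2 ^ (d + 2) * (maxConst r * maxConst (conj r)) ^ (1 / conj r) *
    (ApCharOn univ (conj r) ν ^ (r - 1) * AinfCharOn univ ν * sharpNormOn univ r ν b)

lemma setLIntegral_sub_avg_mul_le_oscBound (hr : 1 < r) (h : IsApOn univ (conj r) ν)
    (hb : L1loc b) (Q₀ : Cube d) {g : Rd d → ℝ≥0∞} (hg : Measurable g) (hgt : ∀ x, g x ≠ ⊤) :
    ∫⁻ x in Q₀.carrier, ENNReal.ofReal |b x - avg Q₀ b| * g x ≤
      oscBound r ν b * (∫⁻ x, g x ^ conj r ∂wMeas ν) ^ (1 / conj r) :=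
  calc ∫⁻ x in Q₀.carrier, ENNReal.ofReal |b x - avg Q₀ b| * g x
      ≤ 2 ^ (d + 2) * ∫⁻ x, ⨆ l, oscMul b g (gridAt Q₀ l x) :=
        setLIntegral_sub_avg_mul_le hb Q₀ hg hgt
    _ ≤ 2 ^ (d + 2) * (AinfCharOn univ ν * (sharpNormOn univ r ν b *
          (ApCharOn univ (conj r) ν ^ (r - 1) *
          (maxConst r * maxConst (conj r)) ^ (1 / conj r) *
          (∫⁻ x, g x ^ conj r ∂wMeas ν) ^ (1 / conj r)))) := by
        gcongr
        refine (lintegral_iSup_oscMul_le h.1 Q₀ g).trans ?_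
        gcongr
        exact lintegral_dyadicSharp_mul_le hr h hb Q₀ hg
    _ = _ := by rw [oscBound]; ring

lemma setLIntegral_rpow_sub_avg_le (hr : 1 < r) (h : IsApOn univ (conj r) ν) (hb : L1loc b)
    (Q₀ : Cube d) :
    ∫⁻ x in Q₀.carrier, ENNReal.ofReal |b x - avg Q₀ b| ^ r * ENNReal.ofReal (dualWeight r ν x) ≤
      oscBound r ν b ^ r := by
  have hp := one_lt_conj hr
  have hr0 : 0 < r := by linarith
  have hr1 : 0 < r - 1 := by linarith
  have hσ := isWeight_dualWeight hr h
  have hσm := hσ.2.1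
  have hbm := hb.1
  set σ := dualWeight r ν
  set f : Rd d → ℝ≥0∞ := fun x => ENNReal.ofReal |b x - avg Q₀ b| with hf
  have hfm : Measurable f := by fun_prop
  let t : ℕ → Rd d → ℝ≥0∞ := fun n x => min (f x) n
  have htm : ∀ n, Measurable (t n) := fun n => hfm.min measurable_const
  refine lintegral_le_of_tendsto (F := fun n x => t n x ^ r * ENNReal.ofReal (σ x))
    (fun n => ((htm n).pow_const r).mul hσm.ennreal_ofReal) (ae_of_all _ fun x => ?_) fun n => ?_
  · obtain ⟨N, hN⟩ := ENNReal.exists_nat_gt (show f x ≠ ⊤ by simp [hf])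
    refine tendsto_const_nhds.congr' (eventually_atTop.2 ⟨N, fun n hn => ?_⟩)
    have : f x ≤ n := hN.le.trans (by exact_mod_cast hn)
    simp only [t, min_eq_left this]
    rfl
  · have htn : ∀ x, t n x ≤ n := fun x => min_le_right _ _
    have htt : ∀ x, t n x ≠ ⊤ := fun x => ne_top_of_le_ne_top (by simp) (htn x)
    set X := ∫⁻ x in Q₀.carrier, t n x ^ r * ENNReal.ofReal (σ x) with hX
    let g : Rd d → ℝ≥0∞ :=
      Q₀.carrier.indicator fun x => t n x ^ (r - 1) * ENNReal.ofReal (σ x)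
    have hgm : Measurable g :=
      (((htm n).pow_const _).mul hσm.ennreal_ofReal).indicator Q₀.measurableSet
    have hgt : ∀ x, g x ≠ ⊤ := fun x => by
      by_cases hx : x ∈ Q₀.carrier
      · simp only [g, indicator_of_mem hx]
        have := ENNReal.rpow_ne_top_of_nonneg hr1.le (htt x)
        finiteness
      · simp [g, hx]
    have hXt : X ≠ ⊤ := by
      refine ne_top_of_le_ne_top (b := (n : ℝ≥0∞) ^ r * wMeas σ Q₀.carrier) ?_ ?_
      · have h1 : (n : ℝ≥0∞) ^ r ≠ ⊤ := ENNReal.rpow_ne_top_of_nonneg hr0.le (by simp)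
        have h2 := wMeas_ne_top hσ Q₀
        finiteness
      · rw [wMeas, withDensity_apply _ Q₀.measurableSet,
          ← lintegral_const_mul _ hσm.ennreal_ofReal]
        refine lintegral_mono fun x => ?_
        gcongr
        exact htn x
    have hXg : X ≤ ∫⁻ x in Q₀.carrier, f x * g x := by
      refine setLIntegral_mono' Q₀.measurableSet fun x hx => ?_
      simp only [g, indicator_of_mem hx]
      rw [← mul_assoc]
      gcongr
      calc t n x ^ r = t n x * t n x ^ (r - 1) := by
            nth_rewrite 2 [← ENNReal.rpow_one (t n x)]
            rw [← ENNReal.rpow_add_of_nonneg _ _ zero_le_one hr1.le, add_sub_cancel]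
        _ ≤ f x * t n x ^ (r - 1) := by
            gcongr
            exact min_le_left _ _
    have hgX : ∫⁻ x, g x ^ conj r ∂wMeas ν = X := by
      rw [lintegral_wMeas h.1.2.1 (by fun_prop), hX, ← lintegral_indicator Q₀.measurableSet]
      refine lintegral_congr fun x => ?_
      by_cases hx : x ∈ Q₀.carrier
      · have hu0 : ENNReal.ofReal (ν x) ≠ 0 := by simpa using h.1.1 x
        simp only [g, indicator_of_mem hx]
        rw [ENNReal.mul_rpow_of_nonneg _ _ (by positivity), ← ENNReal.rpow_mul,
          sub_one_mul_conj hr, ofReal_dualWeight h.1, mul_assoc, ← ENNReal.rpow_mul]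
        congr 1
        nth_rewrite 2 [← ENNReal.rpow_one (ENNReal.ofReal (ν x))]
        rw [← ENNReal.rpow_add _ _ hu0 (by simp)]
        congr 1
        linear_combination -sub_one_mul_conj hr
      · simp [g, hx, show 0 < conj r by positivity]
    have hmain : X ≤ oscBound r ν b * X ^ (1 / conj r) := by
      have h1 := setLIntegral_sub_avg_mul_le_oscBound hr h hb Q₀ hgm hgt
      rw [hgX] at h1
      exact hXg.trans h1
    by_cases hX0 : X = 0
    · simp [hX0]
    rw [← ENNReal.rpow_inv_le_iff hr0]
    have he : X ^ r⁻¹ * X ^ (1 / conj r) = X := by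
      rw [← ENNReal.rpow_add _ _ hX0 hXt]
      have : r⁻¹ + 1 / conj r = 1 := by
        rw [conj]
        field_simp
        ring
      rw [this, ENNReal.rpow_one]
    refine (ENNReal.mul_le_mul_iff_left (c := X ^ (1 / conj r)) ?_ ?_).1 (he.trans_le hmain)
    · exact (ENNReal.rpow_pos (pos_iff_ne_zero.2 hX0) hXt).ne'
    · exact ENNReal.rpow_ne_top_of_nonneg (by positivity) hXt

end Duality

section Assembly

variable {ν b : Rd d → ℝ} {r : ℝ}

/-- The cube `[-(N+1), N+1)^d`. -/
def centredCube (d N : ℕ) : Cube d := ⟨fun _ => -(N + 1 : ℝ), 2 * (N + 1), by positivity⟩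

lemma mem_centredCube {N : ℕ} {x : Rd d} (hx : ‖x‖ ≤ N) : x ∈ (centredCube d N).carrier :=
  fun i => by
    have h := abs_le.1 ((PiLp.norm_apply_le x i).trans hx)
    simp only [centredCube]
    constructor <;> linarith [h.1, h.2]

lemma centredCube_zero_subset (N : ℕ) :
    (centredCube d 0).carrier ⊆ (centredCube d N).carrier := fun x hx i => by
  have h := hx i
  have hN : (0 : ℝ) ≤ N := by positivity
  simp only [centredCube, CharP.cast_eq_zero] at h ⊢
  constructor <;> linarith [h.1, h.2]

lemma rpow_abs_avg_sub_avg_mul_le (hr : 1 < r) (h : IsApOn univ (conj r) ν) (hb : L1loc b)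
    {P Q : Cube d} (hPQ : P.carrier ⊆ Q.carrier) :
    ENNReal.ofReal |avg Q b - avg P b| ^ r * wMeas (dualWeight r ν) P.carrier ≤
      2 ^ (r - 1) * (oscBound r ν b ^ r + oscBound r ν b ^ r) := by
  have hσm := (isWeight_dualWeight hr h).2.1.ennreal_ofReal
  have hbm := hb.1
  calc ENNReal.ofReal |avg Q b - avg P b| ^ r * wMeas (dualWeight r ν) P.carrier
      = ∫⁻ x in P.carrier, ENNReal.ofReal |avg Q b - avg P b| ^ r *
          ENNReal.ofReal (dualWeight r ν x) := by
        rw [wMeas, withDensity_apply _ P.measurableSet, ← lintegral_const_mul _ hσm]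
    _ ≤ ∫⁻ x in P.carrier, 2 ^ (r - 1) * (ENNReal.ofReal |b x - avg Q b| ^ r *
          ENNReal.ofReal (dualWeight r ν x) + ENNReal.ofReal |b x - avg P b| ^ r *
          ENNReal.ofReal (dualWeight r ν x)) := by
        refine lintegral_mono fun x => ?_
        rw [← add_mul, ← mul_assoc]
        gcongr
        refine le_trans ?_ (ENNReal.rpow_add_le_mul_rpow_add_rpow _ _ hr.le)
        rw [← ENNReal.ofReal_add (abs_nonneg _) (abs_nonneg _), abs_sub_comm (b x)]
        gcongr
        exact abs_sub_le _ _ _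
    _ = 2 ^ (r - 1) * ((∫⁻ x in P.carrier, ENNReal.ofReal |b x - avg Q b| ^ r *
          ENNReal.ofReal (dualWeight r ν x)) + ∫⁻ x in P.carrier,
          ENNReal.ofReal |b x - avg P b| ^ r * ENNReal.ofReal (dualWeight r ν x)) := by
        rw [lintegral_const_mul _ (by fun_prop), lintegral_add_left (by fun_prop)]
    _ ≤ _ := by
        gcongr
        · exact (lintegral_mono_set hPQ).trans (setLIntegral_rpow_sub_avg_le hr h hb Q)
        · exact setLIntegral_rpow_sub_avg_le hr h hb P

lemma exists_tendsto_avg (hr : 1 < r) (h : IsApOn univ (conj r) ν) (hb : L1loc b)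
    (hT : oscBound r ν b ≠ ⊤) :
    ∃ (c : ℝ) (φ : ℕ → ℕ), StrictMono φ ∧
      Tendsto (fun n => avg (centredCube d (φ n)) b) atTop (nhds c) := by
  have hr0 : 0 < r := by linarith
  have hσ := isWeight_dualWeight hr h
  set P := centredCube d 0
  set K : ℝ≥0∞ := (2 ^ (r - 1) * (oscBound r ν b ^ r + oscBound r ν b ^ r) /
    wMeas (dualWeight r ν) P.carrier) ^ r⁻¹ with hK
  have hKt : K ≠ ⊤ := by
    have h1 : oscBound r ν b ^ r ≠ ⊤ := ENNReal.rpow_ne_top_of_nonneg hr0.le hT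
    have h2 : (2 : ℝ≥0∞) ^ (r - 1) ≠ ⊤ := ENNReal.rpow_ne_top_of_nonneg (by linarith) (by simp)
    have h3 := wMeas_ne_zero hσ P
    refine ENNReal.rpow_ne_top_of_nonneg (by positivity) (ENNReal.div_ne_top ?_ h3)
    finiteness
  have hbd : ∀ N, avg (centredCube d N) b ∈ Metric.closedBall (avg P b) K.toReal := fun N => by
    rw [Metric.mem_closedBall, Real.dist_eq, ← ENNReal.ofReal_le_iff_le_toReal hKt, hK,
      ENNReal.le_rpow_inv_iff hr0,
      ENNReal.le_div_iff_mul_le (Or.inl (wMeas_ne_zero hσ P)) (Or.inl (wMeas_ne_top hσ P))]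
    exact rpow_abs_avg_sub_avg_mul_le hr h hb (centredCube_zero_subset N)
  obtain ⟨c, -, φ, hφ, hc⟩ := tendsto_subseq_of_bounded Metric.isBounded_closedBall hbd
  exact ⟨c, φ, hφ, hc⟩

lemma wnorm_sub_mul_inv (hr : 1 < r) (hν : IsWeight ν) (c : ℝ) :
    wnorm r ν (fun x => (b x - c) * (ν x)⁻¹) =
      (∫⁻ x, ENNReal.ofReal |b x - c| ^ r * ENNReal.ofReal (dualWeight r ν x)) ^ (1 / r) := by
  rw [wnorm]
  congr 1
  refine lintegral_congr fun x => ?_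
  have hx := hν.1 x
  rw [ENNReal.ofReal_rpow_of_nonneg (abs_nonneg _) (by linarith),
    ← ENNReal.ofReal_mul (by positivity), abs_mul, abs_of_pos (inv_pos.2 hx),
    Real.mul_rpow (abs_nonneg _) (by positivity), mul_assoc, dualWeight, Real.inv_rpow hx.le,
    ← Real.rpow_neg hx.le, sub_eq_neg_add 1 r, Real.rpow_add hx, Real.rpow_one]

lemma iInf_wnorm_le_oscBound (hr : 1 < r) (h : IsApOn univ (conj r) ν) (hb : L1loc b) :
    (⨅ c : ℝ, wnorm r ν fun x => (b x - c) * (ν x)⁻¹) ≤ oscBound r ν b := by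
  by_cases hT : oscBound r ν b = ⊤
  · simp [hT]
  have hr0 : 0 < r := by linarith
  obtain ⟨c, φ, hφ, hc⟩ := exists_tendsto_avg hr h hb hT
  refine (iInf_le _ c).trans ?_
  rw [wnorm_sub_mul_inv hr h.1, one_div, ENNReal.rpow_inv_le_iff hr0]
  have hσm := (isWeight_dualWeight hr h).2.1
  have hbm := hb.1
  refine lintegral_le_of_tendsto
    (F := fun n => (centredCube d (φ n)).carrier.indicator fun x =>
      ENNReal.ofReal |b x - avg (centredCube d (φ n)) b| ^ r *
        ENNReal.ofReal (dualWeight r ν x))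
    (fun n => Measurable.indicator (by fun_prop) (Cube.measurableSet _))
    (ae_of_all _ fun x => ?_) fun n => ?_
  · have hlim : Tendsto (fun n => ENNReal.ofReal |b x - avg (centredCube d (φ n)) b| ^ r *
        ENNReal.ofReal (dualWeight r ν x)) atTop
        (nhds (ENNReal.ofReal |b x - c| ^ r * ENNReal.ofReal (dualWeight r ν x))) :=
      ENNReal.Tendsto.mul_const
        ((ENNReal.tendsto_ofReal (hc.const_sub (b x)).abs).ennrpow_const r)
        (Or.inr ENNReal.ofReal_ne_top)
    refine hlim.congr' ?_
    obtain ⟨N, hN⟩ := exists_nat_ge ‖x‖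
    filter_upwards [eventually_ge_atTop N] with n hn
    rw [indicator_of_mem (mem_centredCube (hN.trans (by exact_mod_cast hn.trans (hφ.id_le n))))]
  · rw [lintegral_indicator (Cube.measurableSet _)]
    exact setLIntegral_rpow_sub_avg_le hr h hb _

lemma exists_iInf_wnorm_le (d : ℕ) (hr : 1 < r) :
    ∃ C : ℝ, 0 < C ∧ ∀ ν : Rd d → ℝ, IsApOn univ (conj r) ν → ∀ b : Rd d → ℝ, L1loc b →
      (⨅ c : ℝ, wnorm r ν fun x => (b x - c) * (ν x)⁻¹) ≤
        ENNReal.ofReal C * ApCharOn univ (conj r) ν ^ (r - 1) *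
          AinfCharOn univ ν * sharpNormOn univ r ν b := by
  have hp := one_lt_conj hr
  set K : ℝ≥0∞ := 2 ^ (d + 2) * (maxConst r * maxConst (conj r)) ^ (1 / conj r) with hK
  have hKt : K ≠ ⊤ := by
    have h1 := maxConst_ne_top hr
    have h2 := maxConst_ne_top hp
    have h3 := ENNReal.rpow_ne_top_of_nonneg (y := 1 / conj r) (by positivity)
      (ENNReal.mul_ne_top h1 h2)
    finiteness
  refine ⟨K.toReal + 1, by positivity, fun ν h b hb => (iInf_wnorm_le_oscBound hr h hb).trans ?_⟩
  rw [oscBound, ← hK, ← mul_assoc, ← mul_assoc]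
  gcongr
  rw [ENNReal.le_ofReal_iff_toReal_le hKt (by positivity)]
  linarith

end Assembly

/-- **Proposition 5.1** (Fefferman–Stein type comparison between the sharp maximal
condition and the multiplier condition). (i) If `ν` is doubling then
`‖M_ν^♯ b‖_{L^r(ν)} ≲_ν inf_c ‖(b−c)ν^{−1}‖_{L^r(ν)}`. (ii) If `ν ∈ A_{r'}` then
`inf_c ‖(b−c)ν^{−1}‖_{L^r(ν)} ≲ [ν]_{A_{r'}}^{r−1} [ν]_{A_∞} ‖M_ν^♯ b‖_{L^r(ν)}`. -/
theorem stmt16 (d : ℕ) (hd : 0 < d) (r : ℝ) (hr : 1 < r) :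
    (∀ ν : Rd d → ℝ, IsWeight ν → DoublingWeight ν →
      ∃ C : ℝ, 0 < C ∧
        ∀ b : Rd d → ℝ, L1loc b →
          sharpNormOn Set.univ r ν b ≤
            ENNReal.ofReal C * ⨅ c : ℝ, wnorm r ν fun x => (b x - c) * (ν x)⁻¹) ∧
    (∃ C : ℝ, 0 < C ∧
      ∀ ν : Rd d → ℝ, IsWeight ν → IsApOn Set.univ (conj r) ν →
        ∀ b : Rd d → ℝ, L1loc b →
          (⨅ c : ℝ, wnorm r ν fun x => (b x - c) * (ν x)⁻¹) ≤
            ENNReal.ofReal C * ApCharOn Set.univ (conj r) ν ^ (r - 1) *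
              AinfCharOn Set.univ ν * sharpNormOn Set.univ r ν b) := by

  exact ⟨fun ν hν hdbl => sharpNorm_le_of_doubling hr hν hdbl,
    (exists_iInf_wnorm_le d hr).imp fun _ hC => ⟨hC.1, fun ν _ h => hC.2 ν h⟩⟩
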